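/- Let G be a countable ICC group and A a finite set with |A| ≥ 2. Then the set of shifts S ∈ 𝒮 for which the G-action on S is faithful, minimal and proximal contains a dense G_δ subset of 𝒮; in particular it is nonempty. -/

import Mathlib

open scoped Pointwise

/-- The left-translation action of `G` on configurations: `(g • s)(h) = s (g⁻¹ * h)`. -/
def shiftAct {G A : Type*} [Group G] (g : G) (s : G → A) : G → A :=
  fun h => s (g⁻¹ * h)

/-- A shift: a nonempty, closed, `G`-invariant subset of the full shift `A^G` (with the
product topology and the left-translation action). -/
def IsShift {G A : Type*} [Group G] [TopologicalSpace A] (S : Set (G → A)) : Prop :=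
  S.Nonempty ∧ IsClosed S ∧ ∀ s ∈ S, ∀ g : G, shiftAct g s ∈ S

/-- A shift `S ⊆ A^G` is strongly irreducible if there is a finite `X ⊆ G` containing the
identity such that for all `E₁, E₂ ⊆ G` with `E₁X ∩ E₂X = ∅` and all `s₁, s₂ ∈ S` there is
`s ∈ S` agreeing with `s₁` on `E₁` and with `s₂` on `E₂`. -/
def StronglyIrreducible {G A : Type*} [Group G] (S : Set (G → A)) : Prop :=
  ∃ X : Finset G, (1 : G) ∈ X ∧
    ∀ E₁ E₂ : Set G, (E₁ * (X : Set G)) ∩ (E₂ * (X : Set G)) = ∅ →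
      ∀ s₁ ∈ S, ∀ s₂ ∈ S, ∃ s ∈ S, (∀ a ∈ E₁, s a = s₁ a) ∧ (∀ a ∈ E₂, s a = s₂ a)

open scoped Classical in
/-- The metric on `A^G` induced by an enumeration `G = {g₁, g₂, …}` (here `e n = g_{n+1}`):
`d(s, t) = 1 / min {n ≥ 1 : s gₙ ≠ t gₙ}` for `s ≠ t`, and `d(s, s) = 0`. -/
noncomputable def confDist {G A : Type*} (e : ℕ → G) (s t : G → A) : ℝ :=
  if s = t then 0
  else 1 / (((sInf {n : ℕ | s (e n) ≠ t (e n)} : ℕ) : ℝ) + 1)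

/-- The space of shifts in `A^G`. -/
abbrev ShiftSpace (G A : Type*) [Group G] [TopologicalSpace A] : Type _ :=
  {S : Set (G → A) // IsShift S}

/-- Two sets of configurations agree on `F ⊆ G` if they have the same sets of restrictions
to `F`. -/
def AgreeOn {G A : Type*} (F : Set G) (S T : Set (G → A)) : Prop :=
  ∀ p : G → A, (∃ s ∈ S, ∀ x ∈ F, s x = p x) ↔ (∃ t ∈ T, ∀ x ∈ F, t x = p x)

open scoped Classical in
/-- The metric on the space of shifts: `d(S, T) = 1/(n+1)` where `n` is the largest index
such that `S` and `T` agree on `{g₁, …, gₙ}` (with `e k = g_{k+1}`), and `d(S, T) = 0` if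
`S = T`. -/
noncomputable def shiftSpaceDist {G A : Type*} [Group G] [TopologicalSpace A] (e : ℕ → G)
    (S T : ShiftSpace G A) : ℝ :=
  if S = T then 0
  else 1 / (((sSup {n : ℕ | AgreeOn {g : G | ∃ k < n, e k = g} S.1 T.1} : ℕ) : ℝ) + 1)

/-- The metric topology on the space of shifts, generated by the open balls of the metric
`shiftSpaceDist`. -/
noncomputable def shiftSpaceTopology (G A : Type*) [Group G] [TopologicalSpace A]
    (e : ℕ → G) : TopologicalSpace (ShiftSpace G A) :=
  TopologicalSpace.generateFrom
    {U : Set (ShiftSpace G A) |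
      ∃ (S : ShiftSpace G A) (ε : ℝ), 0 < ε ∧ U = {T | shiftSpaceDist e S T < ε}}

/-- The space `𝒮`: the closure, in the space of shifts, of the strongly irreducible shifts,
with the `|A|` singleton (constant-configuration) shifts removed. -/
def scriptS (G A : Type*) [Group G] [TopologicalSpace A] (e : ℕ → G) :
    Set (ShiftSpace G A) :=
  @closure _ (shiftSpaceTopology G A e) {S : ShiftSpace G A | StronglyIrreducible S.1} \
    {S : ShiftSpace G A | ∃ a : A, S.1 = {fun _ => a}}

/-- The subspace topology on `𝒮`. -/
noncomputable def scriptSTopology (G A : Type*) [Group G] [TopologicalSpace A]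
    (e : ℕ → G) : TopologicalSpace ↥(scriptS G A e) :=
  TopologicalSpace.induced Subtype.val (shiftSpaceTopology G A e)

/-- A group is ICC if it is nontrivial and every non-identity element has an infinite
conjugacy class. -/
def IsICC (G : Type*) [Group G] : Prop :=
  Nontrivial G ∧ ∀ g : G, g ≠ 1 → {h : G | IsConj g h}.Infinite

/-- The action of `G` on a shift `S` is minimal if every orbit is dense in `S`. -/
def MinimalShift {G A : Type*} [Group G] [TopologicalSpace A] (S : Set (G → A)) : Prop :=
  ∀ s ∈ S, S ⊆ closure {x : G → A | ∃ g : G, x = shiftAct g s}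

/-- The action of `G` on a shift `S` is proximal if for all `s, t ∈ S` the closure of
`{(g • s, g • t) : g ∈ G}` meets the diagonal of `S × S`. -/
def ProximalShift {G A : Type*} [Group G] [TopologicalSpace A] (S : Set (G → A)) : Prop :=
  ∀ s ∈ S, ∀ t ∈ S, ∃ z ∈ S,
    (z, z) ∈ closure {p : (G → A) × (G → A) | ∃ g : G, p = (shiftAct g s, shiftAct g t)}

/-- The action of `G` on a shift `S` is faithful if every non-identity element of `G` moves
some configuration of `S`. -/
def FaithfulShift {G A : Type*} [Group G] (S : Set (G → A)) : Prop :=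
  ∀ g : G, g ≠ 1 → ∃ s ∈ S, shiftAct g s ≠ s

open Finset in
theorem card_filter_forall_exists_ne_mul_le {W κ : Type*} [Fintype W] [DecidableEq W]
    (I : Finset κ) (U : κ → Finset W) (a : κ → W → Bool) (u : ℕ)
    (hU : ∀ i ∈ I, (U i).card ≤ u) (hd : (I : Set κ).PairwiseDisjoint U) :
    ((univ : Finset (W → Bool)).filter fun c => ∀ i ∈ I, ∃ w ∈ U i, c w ≠ a i w).card *
      (2 ^ u) ^ I.card ≤ 2 ^ Fintype.card W * (2 ^ u - 1) ^ I.card := by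
  classical
  induction I using Finset.induction_on with
  | empty => simp
  | insert i I hi ih =>
    have ih' := ih (fun j hj => hU j (mem_insert_of_mem hj))
      (hd.subset (by simp))
    set B := (univ : Finset (W → Bool)).filter fun c => ∀ i ∈ I, ∃ w ∈ U i, c w ≠ a i w with hB
    set B₁ := (univ : Finset (W → Bool)).filter
      fun c => ∀ j ∈ insert i I, ∃ w ∈ U j, c w ≠ a j w with hB₁
    set B₂ := B.filter fun c => ∀ w ∈ U i, c w = a i w with hB₂
    have hadd : B₂.card + B₁.card = B.card := by
      rw [← card_filter_add_card_filter_not (s := B) (fun c => ∀ w ∈ U i, c w = a i w)]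
      congr 2
      ext c
      simp only [hB, hB₁, mem_filter, mem_univ, true_and, forall_mem_insert]
      push Not
      tauto
    have hle : B.card ≤ B₂.card * 2 ^ u := by
      refine (?_ : B.card ≤ B₂.card * 2 ^ (U i).card).trans
        (Nat.mul_le_mul_left _ (Nat.pow_le_pow_right (by norm_num) (hU i (mem_insert_self _ _))))
      have : (B₂ ×ˢ (U i).powerset).card = B₂.card * 2 ^ (U i).card := by
        rw [card_product, card_powerset]
      rw [← this]
      refine card_le_card_of_injOn
        (fun c => ((fun w => if w ∈ U i then a i w else c w), (U i).filter fun w => c w = true))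
        ?_ ?_
      · intro c hc
        simp only [hB, coe_filter, mem_univ, true_and, Set.mem_ofPred_eq] at hc
        simp only [coe_product, Set.mem_prod, mem_coe, hB₂, hB, mem_filter, mem_univ, true_and,
          mem_powerset, filter_subset, and_true]
        refine ⟨fun j hj => ?_, fun w hw => by simp [hw]⟩
        obtain ⟨w, hw, hne⟩ := hc j hj
        refine ⟨w, hw, ?_⟩
        have hij : i ≠ j := fun h => hi (h ▸ hj)
        have := hd (by simp) (by simp [hj]) hij
        rw [if_neg fun h => (disjoint_left.1 this) h hw]
        exact hne
      · intro c _ c' _ h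
        simp only [Prod.mk.injEq] at h
        ext1 w
        by_cases hw : w ∈ U i
        · have := Finset.ext_iff.1 h.2 w
          simp only [mem_filter, hw, true_and] at this
          exact Bool.eq_iff_iff.2 this
        · simpa [hw] using congrFun h.1 w
    have hpos : 1 ≤ 2 ^ u := Nat.one_le_two_pow
    have h₁ : B₁.card * 2 ^ u ≤ B.card * (2 ^ u - 1) := by
      obtain ⟨m, hm⟩ := Nat.exists_eq_add_of_le hpos
      rw [hm] at hle ⊢
      simp only [add_tsub_cancel_left]
      nlinarith
    rw [card_insert_of_notMem hi, pow_succ, pow_succ]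
    calc B₁.card * ((2 ^ u) ^ I.card * 2 ^ u) = (B₁.card * 2 ^ u) * (2 ^ u) ^ I.card := by ring
      _ ≤ (B.card * (2 ^ u - 1)) * (2 ^ u) ^ I.card := Nat.mul_le_mul_right _ h₁
      _ = (B.card * (2 ^ u) ^ I.card) * (2 ^ u - 1) := by ring
      _ ≤ _ := by rw [← mul_assoc]; exact Nat.mul_le_mul_right _ ih'

open Finset in
/-- A union bound: a Boolean labelling passing at least one of many independent local tests, for
each of a controlled number of families of tests. -/
theorem exists_forall_exists_forall_eq {α ι κ : Type*} [DecidableEq α] (J : Finset ι)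
    (I : ι → Finset κ) (U : ι → κ → Finset α) (a : ι → κ → α → Bool) (u n : ℕ)
    (hU : ∀ j ∈ J, ∀ i ∈ I j, (U j i).card ≤ u)
    (hd : ∀ j ∈ J, (I j : Set κ).PairwiseDisjoint (U j)) (hn : ∀ j ∈ J, n ≤ (I j).card)
    (hJ : J.card * (2 ^ u - 1) ^ n < (2 ^ u) ^ n) :
    ∃ c : α → Bool, ∀ j ∈ J, ∃ i ∈ I j, ∀ w ∈ U j i, c w = a j i w := by
  classical
  let W : Finset α := J.biUnion fun j => (I j).biUnion (U j)
  have hW : ∀ j ∈ J, ∀ i ∈ I j, U j i ⊆ W := fun j hj i hi w hw =>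
    mem_biUnion.2 ⟨j, hj, mem_biUnion.2 ⟨i, hi, hw⟩⟩
  let U' : ι → κ → Finset W := fun j i => (U j i).subtype (· ∈ W)
  let bad : ι → Finset (W → Bool) := fun j =>
    univ.filter fun c => ∀ i ∈ I j, ∃ w ∈ U' j i, c w ≠ a j i w
  have hbad : ∀ j ∈ J, (bad j).card * (2 ^ u) ^ n ≤ 2 ^ Fintype.card W * (2 ^ u - 1) ^ n := by
    intro j hj
    obtain ⟨I', hI', hcard⟩ := exists_subset_card_eq (hn j hj)
    have h := card_filter_forall_exists_ne_mul_le I' (U' j) (fun i w => a j i w) u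
      (fun i hi => by
        rw [card_subtype]
        exact (card_filter_le _ _).trans (hU j hj i (hI' hi)))
      (fun i hi i' hi' hne => by
        refine disjoint_left.2 fun w hw hw' => ?_
        exact disjoint_left.1 (hd j hj (hI' hi) (hI' hi') hne) (mem_subtype.1 hw)
          (mem_subtype.1 hw'))
    rw [hcard] at h
    refine le_trans (Nat.mul_le_mul_right _ (card_le_card ?_)) h
    intro c hc
    simp only [bad, mem_filter, mem_univ, true_and] at hc ⊢
    exact fun i hi => hc i (hI' hi)
  have hlt : (J.biUnion bad).card < (univ : Finset (W → Bool)).card := by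
    have h2 : (univ : Finset (W → Bool)).card = 2 ^ Fintype.card W := by
      rw [card_univ, Fintype.card_fun, Fintype.card_bool]
    rw [h2]
    have hsum : (J.biUnion bad).card * (2 ^ u) ^ n ≤
        J.card * (2 ^ Fintype.card W * (2 ^ u - 1) ^ n) := by
      refine (Nat.mul_le_mul_right _ card_biUnion_le).trans ?_
      rw [sum_mul, ← smul_eq_mul, ← sum_const]
      exact sum_le_sum hbad
    refine lt_of_mul_lt_mul_right (a := (2 ^ u) ^ n) ?_ (Nat.zero_le _)
    calc _ ≤ _ := hsum
      _ = 2 ^ Fintype.card W * (J.card * (2 ^ u - 1) ^ n) := by ring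
      _ < _ := Nat.mul_lt_mul_of_pos_left hJ (by positivity)
  obtain ⟨c, -, hc⟩ := exists_mem_notMem_of_card_lt_card hlt
  refine ⟨fun w => if h : w ∈ W then c ⟨w, h⟩ else true, fun j hj => ?_⟩
  have : c ∉ bad j := fun h => hc (mem_biUnion.2 ⟨j, hj, h⟩)
  simp only [bad, mem_filter, mem_univ, true_and] at this
  push Not at this
  obtain ⟨i, hi, hw⟩ := this
  refine ⟨i, hi, fun w hwU => ?_⟩
  have hwW := hW j hj i hi hwU
  simpa [hwW] using hw ⟨w, hwW⟩ (mem_subtype.2 hwU)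

theorem exists_mul_pow_mul_pow_lt (C d u : ℕ) :
    ∃ n : ℕ, C * (n + 3) ^ d * (2 ^ u - 1) ^ (n + 1) < (2 ^ u) ^ (n + 1) := by
  have hpos : (0 : ℝ) < 2 ^ u := by positivity
  have h1 : (1 : ℝ) ≤ 2 ^ u := one_le_pow₀ (by norm_num)
  set r : ℝ := (2 ^ u - 1) / 2 ^ u with hr
  have hr0 : 0 ≤ r := div_nonneg (by linarith) hpos.le
  have hr1 : |r| < 1 := by
    rw [abs_of_nonneg hr0, hr, div_lt_one hpos]; linarith
  have ht := (tendsto_pow_const_mul_const_pow_of_abs_lt_one d hr1).const_mul ((C : ℝ) * 3 ^ d)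
  rw [mul_zero] at ht
  obtain ⟨n, hn, hn1⟩ := ((ht.eventually (gt_mem_nhds one_pos)).and
    (Filter.eventually_ge_atTop 1)).exists
  obtain ⟨m, rfl⟩ := Nat.exists_eq_add_of_le' hn1
  refine ⟨m, ?_⟩
  have h2 : ((2 ^ u - 1 : ℕ) : ℝ) = 2 ^ u - 1 := by
    rw [Nat.cast_sub Nat.one_le_two_pow]; simp
  have hle : ((m : ℝ) + 3) ^ d ≤ 3 ^ d * ((m : ℝ) + 1) ^ d := by
    rw [← mul_pow]
    gcongr
    have : (0 : ℝ) ≤ m := Nat.cast_nonneg m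
    linarith
  have key : (C : ℝ) * (m + 3) ^ d * (2 ^ u - 1) ^ (m + 1) < (2 ^ u) ^ (m + 1) := by
    rw [hr, div_pow] at hn
    push_cast at hn
    have hp : (0 : ℝ) < (2 ^ u) ^ (m + 1) := by positivity
    rw [← mul_assoc, ← mul_div_assoc, div_lt_one hp] at hn
    refine lt_of_le_of_lt ?_ hn
    have h0 : (0 : ℝ) ≤ (2 ^ u - 1) ^ (m + 1) := pow_nonneg (by linarith) _
    have := mul_le_mul_of_nonneg_left hle (Nat.cast_nonneg (α := ℝ) C)
    calc _ ≤ (C : ℝ) * (3 ^ d * (m + 1) ^ d) * (2 ^ u - 1) ^ (m + 1) :=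
          mul_le_mul_of_nonneg_right this h0
      _ = _ := by ring
  have : ((C * (m + 3) ^ d * (2 ^ u - 1) ^ (m + 1) : ℕ) : ℝ) < (((2 ^ u) ^ (m + 1) : ℕ) : ℝ) := by
    push_cast [h2]
    exact key
  exact_mod_cast this

theorem IsICC.infinite {G : Type*} [Group G] (hG : IsICC G) : Infinite G := by
  have := hG.1
  obtain ⟨g, hg⟩ := exists_ne (1 : G)
  exact Set.infinite_univ_iff.1 ((hG.2 g hg).mono (Set.subset_univ _))

theorem IsICC.not_finiteIndex_centralizer {G : Type*} [Group G] (hG : IsICC G) {v : G}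
    (hv : v ≠ 1) : ¬ (Subgroup.centralizer {v}).FiniteIndex := by
  intro h
  have : Finite (G ⧸ Subgroup.centralizer {v}) := inferInstance
  refine hG.2 v hv ((Set.finite_range
    fun q : G ⧸ Subgroup.centralizer {v} => q.out * v * q.out⁻¹).subset ?_)
  intro x hx
  obtain ⟨c, rfl⟩ := isConj_iff.1 hx
  refine ⟨(c : G ⧸ Subgroup.centralizer {v}), ?_⟩
  obtain ⟨z, hz⟩ := QuotientGroup.mk_out_eq_mul (Subgroup.centralizer {v}) c
  have hzv := Subgroup.mem_centralizer_singleton_iff.1 z.2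
  simp only [hz, mul_inv_rev]
  calc c * z * v * ((z : G)⁻¹ * c⁻¹) = c * (z * v) * (z : G)⁻¹ * c⁻¹ := by group
    _ = c * v * c⁻¹ := by rw [hzv]; group

theorem IsICC.exists_forall_conj_notMem {G : Type*} [Group G] (hG : IsICC G)
    (F H V : Finset G) (hH : (1 : G) ∉ H) : ∃ y ∉ F, ∀ h ∈ H, y⁻¹ * h * y ∉ V := by
  classical
  by_contra! hcon
  let f : G × G → G := fun p => if h : ∃ y : G, y⁻¹ * p.1 * y = p.2 then h.choose else 1
  have hf : ∀ p : G × G, ∀ y : G, y⁻¹ * p.1 * y = p.2 → (f p)⁻¹ * p.1 * f p = p.2 := by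
    intro p y hy
    have h : ∃ y : G, y⁻¹ * p.1 * y = p.2 := ⟨y, hy⟩
    simp only [f, dif_pos h]
    exact h.choose_spec
  let s : Finset (G × Subgroup G) := F.image (fun y => (y, ⊥)) ∪
    ((H ×ˢ V).filter (fun p => p.2 ≠ 1)).image fun p => (f p, Subgroup.centralizer {p.2})
  have hcov : ⋃ i ∈ s, i.1 • (i.2 : Set G) = Set.univ := by
    refine Set.eq_univ_of_forall fun y => Set.mem_iUnion₂.2 ?_
    by_cases hy : y ∈ F
    · refine ⟨(y, ⊥), Finset.mem_union_left _ (Finset.mem_image_of_mem _ hy), ?_⟩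
      simp
    · obtain ⟨h, hh, hv⟩ := hcon y hy
      have hv1 : y⁻¹ * h * y ≠ 1 := by
        intro h1
        refine hH ?_
        have : h = 1 := by
          calc h = y * (y⁻¹ * h * y) * y⁻¹ := by group
            _ = 1 := by rw [h1]; group
        exact this ▸ hh
      refine ⟨(f (h, y⁻¹ * h * y), Subgroup.centralizer {y⁻¹ * h * y}),
        Finset.mem_union_right _ (Finset.mem_image.2 ⟨(h, y⁻¹ * h * y), ?_, rfl⟩), ?_⟩
      · simp [hh, hv, hv1]
      · have hf' := hf (h, y⁻¹ * h * y) y rfl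
        simp only at hf' ⊢
        set x := f (h, y⁻¹ * h * y)
        rw [mem_leftCoset_iff, SetLike.mem_coe, Subgroup.mem_centralizer_singleton_iff]
        calc x⁻¹ * y * (y⁻¹ * h * y) = (x⁻¹ * h * x) * (x⁻¹ * y) := by group
          _ = y⁻¹ * h * y * (x⁻¹ * y) := by rw [hf']
  obtain ⟨k, hk, hfin⟩ := Subgroup.exists_finiteIndex_of_leftCoset_cover hcov
  rcases Finset.mem_union.1 hk with hk | hk
  · obtain ⟨y, -, rfl⟩ := Finset.mem_image.1 hk
    have := hG.infinite
    have h2 : (⊥ : Subgroup G).index ≠ 0 := hfin.index_ne_zero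
    simp at h2
  · obtain ⟨p, hp, rfl⟩ := Finset.mem_image.1 hk
    exact hG.not_finiteIndex_centralizer (Finset.mem_filter.1 hp).2 hfin

open scoped Classical in
/-- An ICC group contains arbitrarily large finite sets `Y` such that the sets `y V z⁻¹` with
`y, z ∈ Y` hardly overlap outside the identity. -/
theorem IsICC.exists_generic {G : Type*} [Group G] (hG : IsICC G) (V : Finset G)
    (hV1 : (1 : G) ∈ V) (hV : ∀ v ∈ V, v⁻¹ ∈ V) (N : ℕ) :
    ∃ Y : Finset G, Y.card = N ∧ (∀ y ∈ Y, ∀ z ∈ Y, y⁻¹ * z ∈ V * V → y = z) ∧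
      ∀ h : G, h ≠ 1 → (Y.filter fun y => ∃ z ∈ Y, y⁻¹ * h * z ∈ V).card ≤ 2 := by
  induction N with
  | zero => exact ⟨∅, by simp⟩
  | succ N ih =>
    obtain ⟨Y, hcard, hsep, hY⟩ := ih
    let H : Finset G := (Y * V * Y⁻¹).erase 1
    obtain ⟨y, hyF, hyH⟩ := hG.exists_forall_conj_notMem
      (Y * (V * V) ∪ H * Y * V ∪ H⁻¹ * Y * V) H V (by simp [H])
    simp only [Finset.mem_union, not_or] at hyF
    obtain ⟨⟨hy1, hy2⟩, hy3⟩ := hyF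
    have hVV : ∀ v ∈ V * V, v⁻¹ ∈ V * V := by
      intro v hv
      obtain ⟨a, ha, b, hb, rfl⟩ := Finset.mem_mul.1 hv
      rw [mul_inv_rev]
      exact Finset.mul_mem_mul (hV b hb) (hV a ha)
    have hsep1 : ∀ z ∈ Y, z⁻¹ * y ∉ V * V := fun z hz h =>
      hy1 (by simpa using Finset.mul_mem_mul hz h)
    have hsep2 : ∀ z ∈ Y, y⁻¹ * z ∉ V * V := fun z hz h =>
      hsep1 z hz (by simpa using hVV _ h)
    have hyY : y ∉ Y := fun h => hsep1 y h (by simpa using Finset.mul_mem_mul hV1 hV1)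
    refine ⟨insert y Y, by rw [Finset.card_insert_of_notMem hyY, hcard], ?_, ?_⟩
    · intro a ha b hb hab
      rcases Finset.mem_insert.1 ha with rfl | ha' <;> rcases Finset.mem_insert.1 hb with rfl | hb'
      · rfl
      · exact (hsep2 b hb' hab).elim
      · exact (hsep1 a ha' hab).elim
      · exact hsep a ha' b hb' hab
    · intro h hh
      by_cases hH : h ∈ H
      · refine (Finset.card_le_card ?_).trans (hY h hh)
        intro a ha
        obtain ⟨ha, b, hb, hab⟩ := Finset.mem_filter.1 ha
        have e1 : ∀ b ∈ Y, y⁻¹ * h * b ∉ V := fun b hb hv => hy2 <| by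
          have := Finset.mul_mem_mul (Finset.mul_mem_mul hH hb) (hV _ hv)
          simpa [mul_assoc] using this
        have e2 : ∀ a ∈ Y, a⁻¹ * h * y ∉ V := fun a ha hv => hy3 <| by
          have := Finset.mul_mem_mul (Finset.mul_mem_mul (Finset.inv_mem_inv hH) ha) hv
          simpa [mul_assoc] using this
        rcases Finset.mem_insert.1 ha with rfl | ha'
        · rcases Finset.mem_insert.1 hb with rfl | hb'
          · exact (hyH h hH hab).elim
          · exact (e1 b hb' hab).elim
        · rcases Finset.mem_insert.1 hb with rfl | hb'
          · exact (e2 a ha' hab).elim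
          · exact Finset.mem_filter.2 ⟨ha', b, hb', hab⟩
      · have hnot : ∀ a ∈ Y, ∀ b ∈ Y, a⁻¹ * h * b ∉ V := by
          intro a ha b hb hv
          refine hH (Finset.mem_erase.2 ⟨hh, ?_⟩)
          have := Finset.mul_mem_mul (Finset.mul_mem_mul ha hv) (Finset.inv_mem_inv hb)
          simpa [mul_assoc] using this
        have hone : (Y.filter fun a => a⁻¹ * h * y ∈ V).card ≤ 1 := by
          refine Finset.card_le_one.2 fun a ha b hb => ?_
          obtain ⟨ha, hva⟩ := Finset.mem_filter.1 ha
          obtain ⟨hb, hvb⟩ := Finset.mem_filter.1 hb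
          refine hsep a ha b hb ?_
          have := Finset.mul_mem_mul hva (hV _ hvb)
          simpa [mul_assoc] using this
        refine (Finset.card_le_card (t := insert y (Y.filter fun a => a⁻¹ * h * y ∈ V)) ?_).trans
          ((Finset.card_insert_le _ _).trans (by omega))
        intro a ha
        obtain ⟨ha, b, hb, hab⟩ := Finset.mem_filter.1 ha
        rcases Finset.mem_insert.1 ha with rfl | ha'
        · exact Finset.mem_insert_self _ _
        · rcases Finset.mem_insert.1 hb with rfl | hb'
          · exact Finset.mem_insert_of_mem (Finset.mem_filter.2 ⟨ha', hab⟩)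
          · exact (hnot a ha' b hb' hab).elim

open scoped Classical in
theorem IsICC.exists_hitting {G : Type*} [Group G] (hG : IsICC G) (Q : Finset G)
    (hQ1 : (1 : G) ∈ Q) (hQ : ∀ q ∈ Q, q⁻¹ ∈ Q) :
    ∃ Y T : Finset G, Y.Nonempty ∧ T.Nonempty ∧ (∀ y ∈ Y, ∀ z ∈ Y, y⁻¹ * z ∈ Q → y = z) ∧
      (∀ y ∈ T, ∀ z ∈ T, y⁻¹ * z ∈ Q → y = z) ∧
      ∀ k ∈ Y * Q * Y⁻¹, ∀ k' : G, ∃ y ∈ Y, k * y ∈ T ∧ ∀ q ∈ Q, k' * y * q ∈ T → q = 1 := by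
  obtain ⟨n, hn⟩ := exists_mul_pow_mul_pow_lt (Q.card ^ 3) 6 (2 * Q.card)
  have hQV : Q ⊆ Q * Q := fun q hq => by simpa using Finset.mul_mem_mul hq hQ1
  have hV1 : (1 : G) ∈ Q * Q := hQV hQ1
  have hV : ∀ v ∈ Q * Q, v⁻¹ ∈ Q * Q := by
    intro v hv
    obtain ⟨a, ha, b, hb, rfl⟩ := Finset.mem_mul.1 hv
    rw [mul_inv_rev]
    exact Finset.mul_mem_mul (hQ b hb) (hQ a ha)
  have hVV : Q * Q ⊆ Q * Q * (Q * Q) := fun q hq => by simpa using Finset.mul_mem_mul hq hV1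
  obtain ⟨Y, hYcard, hYsep, hYgen⟩ := hG.exists_generic (Q * Q) hV1 hV (n + 3)
  have hYV : ∀ y ∈ Y, ∀ z ∈ Y, y⁻¹ * z ∈ Q * Q → y = z := fun y hy z hz h =>
    hYsep y hy z hz (hVV h)
  have hYne : Y.Nonempty := Finset.card_pos.1 (by omega)
  set K := Y * Q * Y⁻¹ with hK
  have hKcard : K.card ≤ (n + 3) ^ 2 * Q.card := by
    calc K.card ≤ (Y * Q).card * Y⁻¹.card := Finset.card_mul_le
      _ ≤ Y.card * Q.card * Y.card := by
        rw [Finset.card_inv]; exact Nat.mul_le_mul_right _ Finset.card_mul_le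
      _ = _ := by rw [hYcard]; ring
  let I : G × G → Finset G := fun j =>
    Y.filter fun y => ¬ (j.1⁻¹ * j.2 ≠ 1 ∧ ∃ z ∈ Y, y⁻¹ * (j.1⁻¹ * j.2) * z ∈ Q * Q)
  let U : G × G → G → Finset G := fun j y => Q.image (j.1 * y * ·) ∪ Q.image (j.2 * y * ·)
  have hIY : ∀ j, I j ⊆ Y := fun j => Finset.filter_subset _ _
  have hI : ∀ j : G × G, ∀ y ∈ I j, ∀ z ∈ Y, y⁻¹ * (j.1⁻¹ * j.2) * z ∈ Q * Q →
      j.1⁻¹ * j.2 = 1 := fun j y hy z hz h => by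
    by_contra hne
    exact (Finset.mem_filter.1 hy).2 ⟨hne, z, hz, h⟩
  have hcross : ∀ j : G × G, ∀ y ∈ I j, ∀ z ∈ Y, y⁻¹ * (j.1⁻¹ * j.2) * z ∈ Q * Q → y = z := by
    intro j y hy z hz h
    have h1 := hI j y hy z hz h
    rw [h1] at h
    exact hYV y (hIY j hy) z hz (by simpa using h)
  obtain ⟨c, hc⟩ := exists_forall_exists_forall_eq (K ×ˢ (K * K)) I U
    (fun j y w => decide (w = j.1 * y)) (2 * Q.card) (n + 1)
    (fun j _ y _ => by
      refine (Finset.card_union_le _ _).trans ?_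
      have h1 := Finset.card_image_le (s := Q) (f := (j.1 * y * ·))
      have h2 := Finset.card_image_le (s := Q) (f := (j.2 * y * ·))
      omega)
    (fun j _ y hy z hz hne => by
      refine Finset.disjoint_left.2 fun w hw hw' => hne ?_
      simp only [U, Finset.mem_union, Finset.mem_image] at hw hw'
      have hyI := hy
      have hzI := hz
      replace hy := hIY j hy
      replace hz := hIY j hz
      have aux : ∀ a b p q : G, p ∈ Q → q ∈ Q → a * y * p = w → b * z * q = w →
          y⁻¹ * (a⁻¹ * b) * z ∈ Q * Q := by
        intro a b p q hp hq h1 h2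
        have : y⁻¹ * (a⁻¹ * b) * z = p * q⁻¹ := by
          have h3 : b * z = a * y * p * q⁻¹ := by rw [h1, ← h2]; group
          calc y⁻¹ * (a⁻¹ * b) * z = y⁻¹ * a⁻¹ * (b * z) := by group
            _ = _ := by rw [h3]; group
        rw [this]
        exact Finset.mul_mem_mul hp (hQ q hq)
      rcases hw with ⟨p, hp, h1⟩ | ⟨p, hp, h1⟩ <;> rcases hw' with ⟨q, hq, h2⟩ | ⟨q, hq, h2⟩
      · exact hYV y hy z hz (by simpa using aux _ _ p q hp hq h1 h2)
      · exact hcross j y hyI z hz (aux _ _ p q hp hq h1 h2)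
      · refine (hcross j z hzI y hy ?_).symm
        have := hV _ (aux _ _ p q hp hq h1 h2)
        simpa [mul_assoc] using this
      · exact hYV y hy z hz (by simpa using aux _ _ p q hp hq h1 h2))
    (fun j _ => by
      by_cases hj : j.1⁻¹ * j.2 = 1
      · have : I j = Y := Finset.filter_true_of_mem fun y _ h => h.1 hj
        rw [this, hYcard]; omega
      · have h1 := hYgen _ hj
        have h2 : I j = Y.filter fun y => ¬ ∃ z ∈ Y, y⁻¹ * (j.1⁻¹ * j.2) * z ∈ Q * Q := by
          simp only [I]
          exact Finset.filter_congr fun y _ => by simp [hj]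
        have h3 := Finset.card_filter_add_card_filter_not (s := Y)
          (fun y => ∃ z ∈ Y, y⁻¹ * (j.1⁻¹ * j.2) * z ∈ Q * Q)
        rw [h2]
        omega)
    (by
      refine lt_of_le_of_lt (Nat.mul_le_mul_right _ ?_) hn
      rw [Finset.card_product]
      calc K.card * (K * K).card ≤ K.card * (K.card * K.card) :=
            Nat.mul_le_mul_left _ Finset.card_mul_le
        _ ≤ ((n + 3) ^ 2 * Q.card) * (((n + 3) ^ 2 * Q.card) * ((n + 3) ^ 2 * Q.card)) := by
            gcongr
        _ = _ := by ring)
  let T : Finset G := (K * Y).filter fun w => c w = true ∧ ∀ q ∈ Q, q ≠ 1 → c (w * q) = false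
  have hhit : ∀ k ∈ K, ∀ k' ∈ K * K, ∃ y ∈ Y, k * y ∈ T ∧ ∀ q ∈ Q, k' * y * q ∈ T → q = 1 := by
    intro k hk k' hk'
    obtain ⟨y, hy, hyc⟩ := hc (k, k') (Finset.mem_product.2 ⟨hk, hk'⟩)
    simp only [U, Finset.mem_union, Finset.mem_image] at hyc
    refine ⟨y, hIY _ hy, ?_, ?_⟩
    · refine Finset.mem_filter.2 ⟨Finset.mul_mem_mul hk (hIY _ hy), ?_, fun q hq hq1 => ?_⟩
      · simpa using hyc (k * y) (Or.inl ⟨1, hQ1, mul_one _⟩)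
      · simpa [hq1] using hyc (k * y * q) (Or.inl ⟨q, hq, rfl⟩)
    · intro q hq hqT
      have h1 := (Finset.mem_filter.1 hqT).2.1
      rw [hyc (k' * y * q) (Or.inr ⟨q, hq, rfl⟩), decide_eq_true_iff] at h1
      have h2 : y⁻¹ * (k⁻¹ * k') * y = q⁻¹ := by
        have : k' * y = k * y * q⁻¹ := by rw [← h1]; group
        calc y⁻¹ * (k⁻¹ * k') * y = y⁻¹ * k⁻¹ * (k' * y) := by group
          _ = _ := by rw [this]; group
      have h3 := hI (k, k') y hy y (hIY _ hy) (by
        simp only; rw [h2]; exact hQV (hQ q hq))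
      simp only at h3
      rw [h3] at h2
      simpa using h2.symm
  have hK1 : (1 : G) ∈ K := by
    obtain ⟨y, hy⟩ := hYne
    simpa using Finset.mul_mem_mul (Finset.mul_mem_mul hy hQ1) (Finset.inv_mem_inv hy)
  have hKK1 : (1 : G) ∈ K * K := by simpa using Finset.mul_mem_mul hK1 hK1
  refine ⟨Y, T, hYne, ?_, fun y hy z hz h => hYV y hy z hz (hQV h), ?_, ?_⟩
  · obtain ⟨y, -, hy, -⟩ := hhit 1 hK1 1 hKK1
    exact ⟨_, hy⟩
  · intro y hy z hz h
    by_contra hne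
    have h1 := (Finset.mem_filter.1 hy).2.2 _ h (fun h => hne (inv_mul_eq_one.1 h))
    rw [mul_inv_cancel_left, (Finset.mem_filter.1 hz).2.1] at h1
    simp at h1
  · intro k hk k' 
    by_cases hk' : k' ∈ K * K
    · exact hhit k hk k' hk'
    · obtain ⟨y, hy, hyT, -⟩ := hhit k hk 1 hKK1
      refine ⟨y, hy, hyT, fun q hq hqT => (hk' ?_).elim⟩
      have h1 := (Finset.mem_filter.1 hqT).1
      obtain ⟨a, ha, z, hz, haz⟩ := Finset.mem_mul.1 h1
      have : k' = a * (z * q⁻¹ * y⁻¹) := by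
        calc k' = k' * y * q * q⁻¹ * y⁻¹ := by group
          _ = _ := by rw [← haz]; group
      rw [this]
      exact Finset.mul_mem_mul ha
        (Finset.mul_mem_mul (Finset.mul_mem_mul hz (hQ q hq)) (Finset.inv_mem_inv hy))

/-- A maximal `K`-separated subset of a group. -/
def IsNet {G : Type*} [Group G] (K Z : Set G) : Prop :=
  (∀ z ∈ Z, ∀ z' ∈ Z, z⁻¹ * z' ∈ K → z = z') ∧ ∀ g, ∃ z ∈ Z, z⁻¹ * g ∈ K

theorem exists_isNet_superset {G : Type*} [Group G] {K : Set G} (hK1 : (1 : G) ∈ K)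
    (hK : ∀ k ∈ K, k⁻¹ ∈ K) {W : Set G} (hW : ∀ z ∈ W, ∀ z' ∈ W, z⁻¹ * z' ∈ K → z = z') :
    ∃ Z, W ⊆ Z ∧ IsNet K Z := by
  obtain ⟨Z, hWZ, hZ⟩ := zorn_subset_nonempty
    {Z : Set G | ∀ z ∈ Z, ∀ z' ∈ Z, z⁻¹ * z' ∈ K → z = z'}
    (fun c hc hchain _ => by
      refine ⟨⋃₀ c, ?_, fun s hs => Set.subset_sUnion_of_mem hs⟩
      rintro z ⟨s, hs, hz⟩ z' ⟨s', hs', hz'⟩ h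
      rcases hchain.total hs hs' with hss | hss
      · exact hc hs' z (hss hz) z' hz' h
      · exact hc hs z hz z' (hss hz') h) W hW
  refine ⟨Z, hWZ, hZ.prop, fun g => ?_⟩
  by_contra! hg
  have hins : insert g Z ∈ {Z : Set G | ∀ z ∈ Z, ∀ z' ∈ Z, z⁻¹ * z' ∈ K → z = z'} := by
    rintro z (rfl | hz) z' (rfl | hz') h
    · rfl
    · exact (hg z' hz' (by simpa using hK _ h)).elim
    · exact (hg z hz h).elim
    · exact hZ.prop z hz z' hz' h
  have hgZ : g ∈ Z := hZ.le_of_ge hins (Set.subset_insert g Z) (Set.mem_insert g Z)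
  exact hg g hgZ (by simpa using hK1)

theorem IsNet.smul {G : Type*} [Group G] {K Z : Set G} (hZ : IsNet K Z) (g : G) :
    IsNet K (g • Z) := by
  constructor
  · rintro _ ⟨z, hz, rfl⟩ _ ⟨z', hz', rfl⟩ h
    simp only [smul_eq_mul, mul_inv_rev] at h ⊢
    rw [hZ.1 z hz z' hz' (by simpa [mul_assoc] using h)]
  · intro x
    obtain ⟨z, hz, hzx⟩ := hZ.2 (g⁻¹ * x)
    exact ⟨g • z, Set.smul_mem_smul_set hz, by simpa [mul_assoc] using hzx⟩

theorem IsNet.exists_glue {G : Type*} [Group G] {K Z₁ Z₂ : Set G} (hK1 : (1 : G) ∈ K)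
    (hK : ∀ k ∈ K, k⁻¹ ∈ K) (h₁ : IsNet K Z₁) (h₂ : IsNet K Z₂) {E₁ E₂ : Set G}
    (hE : Disjoint (E₁ * (K * K)) (E₂ * (K * K))) :
    ∃ Z, IsNet K Z ∧ (∀ g ∈ E₁, g ∈ Z ↔ g ∈ Z₁) ∧ ∀ g ∈ E₂, g ∈ Z ↔ g ∈ Z₂ := by
  have hfar : ∀ z ∈ E₁ * K, ∀ z' ∈ E₂ * K, z⁻¹ * z' ∉ K := by
    rintro _ ⟨a, ha, k, hk, rfl⟩ _ ⟨b, hb, l, hl, rfl⟩ h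
    refine Set.disjoint_left.1 hE (Set.mul_mem_mul ha (Set.mul_mem_mul hk h)) ?_
    refine ⟨b, hb, l, ⟨l, hl, 1, hK1, mul_one _⟩, ?_⟩
    simp only
    group
  obtain ⟨Z, hWZ, hZ⟩ := exists_isNet_superset hK1 hK
    (W := Z₁ ∩ (E₁ * K) ∪ Z₂ ∩ (E₂ * K)) (by
      rintro z (⟨hz, hzE⟩ | ⟨hz, hzE⟩) z' (⟨hz', hzE'⟩ | ⟨hz', hzE'⟩) h
      · exact h₁.1 z hz z' hz' h
      · exact (hfar z hzE z' hzE' h).elim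
      · exact (hfar z' hzE' z hzE (by simpa using hK _ h)).elim
      · exact h₂.1 z hz z' hz' h)
  have aux : ∀ {E Z' : Set G}, IsNet K Z' → Z' ∩ (E * K) ⊆ Z → ∀ g ∈ E, g ∈ Z ↔ g ∈ Z' := by
    intro E Z' hZ' hsub g hg
    refine ⟨fun hgZ => ?_, fun h => hsub ⟨h, g, hg, 1, hK1, mul_one g⟩⟩
    obtain ⟨z, hz, hzg⟩ := hZ'.2 g
    have hzZ : z ∈ Z := hsub ⟨hz, g, hg, g⁻¹ * z, by simpa using hK _ hzg, by simp⟩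
    rwa [← hZ.1 z hzZ g hgZ hzg]
  exact ⟨Z, hZ, aux h₁ (Set.subset_union_left.trans hWZ), aux h₂ (Set.subset_union_right.trans hWZ)⟩

/-- The points of `Z₂ T`, together with the points of `Z₁ Y` that are not too close to a different
point of `Z₂ T`. -/
def markerSet {G : Type*} [Group G] (Q Y T Z₁ Z₂ : Set G) : Set G :=
  {g | (∃ t ∈ T, g * t⁻¹ ∈ Z₂) ∨
    ((∃ y ∈ Y, g * y⁻¹ ∈ Z₁) ∧ ∀ q ∈ Q, ∀ t ∈ T, g * q * t⁻¹ ∈ Z₂ → q = 1)}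

theorem mem_markerSet_congr {G : Type*} [Group G] {Q Y T Z₁ Z₂ Z₁' Z₂' : Set G}
    (hQ1 : (1 : G) ∈ Q) {g : G} (h₁ : ∀ d ∈ Y⁻¹ ∪ Q * T⁻¹, g * d ∈ Z₁ ↔ g * d ∈ Z₁')
    (h₂ : ∀ d ∈ Y⁻¹ ∪ Q * T⁻¹, g * d ∈ Z₂ ↔ g * d ∈ Z₂') :
    g ∈ markerSet Q Y T Z₁ Z₂ ↔ g ∈ markerSet Q Y T Z₁' Z₂' := by
  have e1 : ∀ y ∈ Y, (g * y⁻¹ ∈ Z₁ ↔ g * y⁻¹ ∈ Z₁') := fun y hy =>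
    h₁ _ (Or.inl (Set.inv_mem_inv.2 hy))
  have e2 : ∀ q ∈ Q, ∀ t ∈ T, (g * q * t⁻¹ ∈ Z₂ ↔ g * q * t⁻¹ ∈ Z₂') := fun q hq t ht => by
    rw [mul_assoc]
    exact h₂ _ (Or.inr (Set.mul_mem_mul hq (Set.inv_mem_inv.2 ht)))
  have e3 : ∀ t ∈ T, (g * t⁻¹ ∈ Z₂ ↔ g * t⁻¹ ∈ Z₂') := fun t ht => by
    simpa using e2 1 hQ1 t ht
  have f1 : (∃ y ∈ Y, g * y⁻¹ ∈ Z₁) ↔ ∃ y ∈ Y, g * y⁻¹ ∈ Z₁' :=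
    exists_congr fun y => and_congr_right (e1 y)
  have f2 : (∀ q ∈ Q, ∀ t ∈ T, g * q * t⁻¹ ∈ Z₂ → q = 1) ↔
      ∀ q ∈ Q, ∀ t ∈ T, g * q * t⁻¹ ∈ Z₂' → q = 1 :=
    forall₂_congr fun q hq => forall₂_congr fun t ht => by rw [e2 q hq t ht]
  have f3 : (∃ t ∈ T, g * t⁻¹ ∈ Z₂) ↔ ∃ t ∈ T, g * t⁻¹ ∈ Z₂' :=
    exists_congr fun t => and_congr_right (e3 t)
  change _ ∨ _ ↔ _ ∨ _
  rw [f1, f2, f3]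

theorem smul_markerSet {G : Type*} [Group G] (Q Y T Z₁ Z₂ : Set G) (g : G) :
    g • markerSet Q Y T Z₁ Z₂ = markerSet Q Y T (g • Z₁) (g • Z₂) := by
  ext x
  simp only [Set.mem_smul_set_iff_inv_smul_mem, smul_eq_mul, markerSet, Set.mem_ofPred_eq,
    mul_assoc]

open scoped Classical in
/-- In an ICC group there is a strongly irreducible invariant family of `Q`-separated subsets any
two of which intersect in a fixed finite set. -/
theorem IsICC.exists_intersecting_family {G : Type*} [Group G] (hG : IsICC G) (Q : Finset G)
    (hQ1 : (1 : G) ∈ Q) (hQ : ∀ q ∈ Q, q⁻¹ ∈ Q) :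
    ∃ 𝒩 : Set (Set G), 𝒩.Nonempty ∧ (∀ N ∈ 𝒩, ∀ g : G, g • N ∈ 𝒩) ∧
      (∀ N ∈ 𝒩, ∀ g ∈ N, ∀ h ∈ N, g⁻¹ * h ∈ Q → g = h) ∧
      (∃ X : Finset G, ∀ E₁ E₂ : Set G, Disjoint (E₁ * (X : Set G)) (E₂ * (X : Set G)) →
        ∀ N₁ ∈ 𝒩, ∀ N₂ ∈ 𝒩, ∃ N ∈ 𝒩, (∀ g ∈ E₁, g ∈ N ↔ g ∈ N₁) ∧ ∀ g ∈ E₂, g ∈ N ↔ g ∈ N₂) ∧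
      ∃ B : Finset G, ∀ N ∈ 𝒩, ∀ N' ∈ 𝒩, ∃ g ∈ B, g ∈ N ∧ g ∈ N' := by
  obtain ⟨Y, T, ⟨y₀, hy₀⟩, ⟨t₀, ht₀⟩, hYsep, hTsep, hhit⟩ := hG.exists_hitting Q hQ1 hQ
  let K₁ : Finset G := Y * Q * Y⁻¹
  let K₂ : Finset G := (T * Q * Y⁻¹) * (T * Q * Y⁻¹)⁻¹
  have hK₁1 : (1 : G) ∈ K₁ := by
    simpa using Finset.mul_mem_mul (Finset.mul_mem_mul hy₀ hQ1) (Finset.inv_mem_inv hy₀)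
  have hK₂' : ∀ a ∈ T * Q * Y⁻¹, ∀ b ∈ T * Q * Y⁻¹, a * b⁻¹ ∈ K₂ := fun a ha b hb =>
    Finset.mul_mem_mul ha (Finset.inv_mem_inv hb)
  have htqy : ∀ t ∈ T, ∀ q ∈ Q, ∀ y ∈ Y, t * q * y⁻¹ ∈ T * Q * Y⁻¹ := fun t ht q hq y hy =>
    Finset.mul_mem_mul (Finset.mul_mem_mul ht hq) (Finset.inv_mem_inv hy)
  have hK₂1 : (1 : G) ∈ K₂ := by
    have := htqy t₀ ht₀ 1 hQ1 y₀ hy₀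
    simpa using hK₂' _ this _ this
  have hK₁inv : ∀ k ∈ K₁, k⁻¹ ∈ K₁ := by
    intro k hk
    obtain ⟨a, ha, b, hb, rfl⟩ := Finset.mem_mul.1 hk
    obtain ⟨y, hy, q, hq, rfl⟩ := Finset.mem_mul.1 ha
    have := Finset.mul_mem_mul (Finset.mul_mem_mul (Finset.mem_inv'.1 hb) (hQ q hq))
      (Finset.inv_mem_inv hy)
    simpa [mul_assoc, K₁] using this
  have hK₂inv : ∀ k ∈ K₂, k⁻¹ ∈ K₂ := by
    intro k hk
    obtain ⟨a, ha, b, hb, rfl⟩ := Finset.mem_mul.1 hk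
    simpa using hK₂' _ (Finset.mem_inv'.1 hb) _ ha
  let 𝒩 : Set (Set G) :=
    {N | ∃ Z₁ Z₂ : Set G, IsNet (K₁ : Set G) Z₁ ∧ IsNet (K₂ : Set G) Z₂ ∧
      N = markerSet (Q : Set G) Y T Z₁ Z₂}
  have hK₂sep : ∀ Z₂, IsNet (K₂ : Set G) Z₂ → ∀ z ∈ Z₂, ∀ z' ∈ Z₂, ∀ t ∈ T, ∀ t' ∈ T,
      ∀ q ∈ Q, ∀ q' ∈ Q, ∀ y ∈ Y, ∀ y' ∈ Y, z * t * q * y⁻¹ = z' * t' * q' * y'⁻¹ → z = z' := by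
    intro Z₂ hZ z hz z' hz' t ht t' ht' q hq q' hq' y hy y' hy' h
    refine hZ.1 z hz z' hz' ?_
    have h1 := hK₂' _ (htqy t ht q hq y hy) _ (htqy t' ht' q' hq' y' hy')
    have h2 : z⁻¹ * z' = t * q * y⁻¹ * (t' * q' * y'⁻¹)⁻¹ := by
      calc z⁻¹ * z' = z⁻¹ * (z' * t' * q' * y'⁻¹) * (t' * q' * y'⁻¹)⁻¹ := by group
        _ = _ := by rw [← h]; group
    rw [h2]
    exact Finset.mem_coe.2 h1
  refine ⟨𝒩, ?_, ?_, ?_, ?_, ?_⟩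
  · obtain ⟨Z₁, -, h₁⟩ := exists_isNet_superset (K := (K₁ : Set G)) hK₁1 hK₁inv (W := ∅) (by simp)
    obtain ⟨Z₂, -, h₂⟩ := exists_isNet_superset (K := (K₂ : Set G)) hK₂1 hK₂inv (W := ∅) (by simp)
    exact ⟨_, Z₁, Z₂, h₁, h₂, rfl⟩
  · rintro _ ⟨Z₁, Z₂, h₁, h₂, rfl⟩ g
    exact ⟨g • Z₁, g • Z₂, h₁.smul g, h₂.smul g, smul_markerSet ..⟩
  · rintro _ ⟨Z₁, Z₂, h₁, h₂, rfl⟩ g hg h hh hgh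
    rcases hg with ⟨t, ht, hgt⟩ | ⟨⟨y, hy, hgy⟩, hgQ⟩ <;>
      rcases hh with ⟨t', ht', hht⟩ | ⟨⟨y', hy', hhy⟩, hhQ⟩
    · have h3 : g * t⁻¹ = h * t'⁻¹ := by
        refine hK₂sep Z₂ h₂ _ hgt _ hht t ht t' ht' (g⁻¹ * h) hgh 1 hQ1 y₀ hy₀ y₀ hy₀ ?_
        group
      have h4 : t = t' := by
        refine hTsep t ht t' ht' ?_
        have : t⁻¹ * t' = g⁻¹ * h := by
          calc t⁻¹ * t' = g⁻¹ * (g * t⁻¹) * t' := by group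
            _ = _ := by rw [h3]; group
        rwa [this]
      subst h4
      exact mul_right_cancel h3
    · have := hhQ _ (hQ _ hgh) t ht (by simpa [mul_assoc] using hgt)
      simpa [inv_mul_eq_one, eq_comm] using this
    · have := hgQ _ hgh t' ht' (by simpa [mul_assoc] using hht)
      simpa [inv_mul_eq_one] using this
    · have h3 : g * y⁻¹ = h * y'⁻¹ := by
        refine h₁.1 _ hgy _ hhy ?_
        have := Finset.mul_mem_mul (Finset.mul_mem_mul hy hgh) (Finset.inv_mem_inv hy')
        rw [Finset.mem_coe]
        simpa [mul_assoc, K₁] using this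
      have h4 : y = y' := by
        refine hYsep y hy y' hy' ?_
        have : y⁻¹ * y' = g⁻¹ * h := by
          calc y⁻¹ * y' = g⁻¹ * (g * y⁻¹) * y' := by group
            _ = _ := by rw [h3]; group
        rwa [this]
      subst h4
      exact mul_right_cancel h3
  · let D : Finset G := Y⁻¹ ∪ Q * T⁻¹
    have hD : (D : Set G) = (Y : Set G)⁻¹ ∪ (Q : Set G) * (T : Set G)⁻¹ := by simp [D]
    refine ⟨D * (K₁ * K₁) ∪ D * (K₂ * K₂), ?_⟩
    rintro E₁ E₂ hE _ ⟨Z₁, Z₂, h₁, h₂, rfl⟩ _ ⟨Z₁', Z₂', h₁', h₂', rfl⟩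
    have hE' : ∀ K ⊆ D * (K₁ * K₁) ∪ D * (K₂ * K₂), Disjoint (E₁ * (K : Set G)) (E₂ * (K : Set G)) :=
      fun K hK => hE.mono (Set.mul_subset_mul_left (Finset.coe_subset.2 hK))
        (Set.mul_subset_mul_left (Finset.coe_subset.2 hK))
    obtain ⟨W₁, hW₁, e₁, e₁'⟩ := IsNet.exists_glue hK₁1 hK₁inv h₁ h₁'
      (E₁ := E₁ * (D : Set G)) (E₂ := E₂ * (D : Set G))
      (by simpa [mul_assoc] using hE' _ Finset.subset_union_left)
    obtain ⟨W₂, hW₂, e₂, e₂'⟩ := IsNet.exists_glue hK₂1 hK₂inv h₂ h₂'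
      (E₁ := E₁ * (D : Set G)) (E₂ := E₂ * (D : Set G))
      (by simpa [mul_assoc] using hE' _ Finset.subset_union_right)
    rw [hD] at e₁ e₁' e₂ e₂'
    exact ⟨_, ⟨W₁, W₂, hW₁, hW₂, rfl⟩,
      fun g hg => mem_markerSet_congr hQ1 (fun d hd => e₁ _ (Set.mul_mem_mul hg hd))
        (fun d hd => e₂ _ (Set.mul_mem_mul hg hd)),
      fun g hg => mem_markerSet_congr hQ1 (fun d hd => e₁' _ (Set.mul_mem_mul hg hd))
        (fun d hd => e₂' _ (Set.mul_mem_mul hg hd))⟩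
  · refine ⟨K₂⁻¹ * K₁ * Y, ?_⟩
    rintro _ ⟨Z₁, Z₂, h₁, h₂, rfl⟩ _ ⟨Z₁', Z₂', h₁', h₂', rfl⟩
    obtain ⟨z', hz', hz'1⟩ := h₂'.2 1
    obtain ⟨z, hz, hzz'⟩ := h₁.2 z'
    have hk : z'⁻¹ * z ∈ K₁ := by simpa using hK₁inv _ hzz'
    have hmem : ∀ y ∈ Y, z * y ∈ K₂⁻¹ * K₁ * Y := by
      intro y hy
      have h1 : z' ∈ K₂⁻¹ := by simpa using hz'1
      simpa using Finset.mul_mem_mul (Finset.mul_mem_mul h1 hk) hy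
    have hN' : ∀ y, z'⁻¹ * z * y ∈ T → z * y ∈ markerSet (Q : Set G) Y T Z₁' Z₂' := fun y hy =>
      Or.inl ⟨_, hy, by simpa [mul_assoc] using hz'⟩
    by_cases hc : ∃ w ∈ Z₂, ∃ y ∈ Y, ∃ q ∈ Q, ∃ t ∈ T, z * y * q = w * t
    · obtain ⟨w, hw, y, hy, q, hq, t, ht, hwt⟩ := hc
      obtain ⟨x, hx, hxT, hxQ⟩ := hhit _ hk (w⁻¹ * z)
      refine ⟨z * x, hmem x hx, Or.inr ⟨⟨x, hx, by simpa using hz⟩, ?_⟩, hN' x hxT⟩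
      intro q' hq' t' ht' hv
      refine hxQ q' hq' ?_
      have hwv : w = z * x * q' * t'⁻¹ := by
        refine hK₂sep Z₂ h₂ w hw _ hv t ht t' ht' q⁻¹ (hQ q hq) q'⁻¹ (hQ q' hq') y hy x hx ?_
        rw [← hwt]
        group
      have : w⁻¹ * z * x * q' = t' := by rw [hwv]; group
      rwa [this]
    · obtain ⟨x, hx, hxT, -⟩ := hhit _ hk 1
      refine ⟨z * x, hmem x hx, Or.inr ⟨⟨x, hx, by simpa using hz⟩, ?_⟩, hN' x hxT⟩
      intro q' hq' t' ht' hv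
      exact (hc ⟨_, hv, x, hx, q', hq', t', ht', by group⟩).elim

/-- Any two configurations of `S` can be glued along sets whose products with `X` are disjoint. -/
def IsGluing {G A : Type*} [Group G] (X : Set G) (S : Set (G → A)) : Prop :=
  ∀ E₁ E₂ : Set G, Disjoint (E₁ * X) (E₂ * X) → ∀ s₁ ∈ S, ∀ s₂ ∈ S,
    ∃ s ∈ S, (∀ a ∈ E₁, s a = s₁ a) ∧ ∀ a ∈ E₂, s a = s₂ a

theorem stronglyIrreducible_iff {G A : Type*} [Group G] {S : Set (G → A)} :
    StronglyIrreducible S ↔ ∃ X : Finset G, (1 : G) ∈ X ∧ IsGluing (X : Set G) S := by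
  simp only [StronglyIrreducible, IsGluing, Set.disjoint_iff_inter_eq_empty]

theorem exists_mem_forall_of_finset {G A : Type*} [Finite A] [TopologicalSpace A]
    [DiscreteTopology A] {S : Set (G → A)} (hS : IsClosed S) (p : G → A → Prop)
    (h : ∀ D : Finset G, ∃ s ∈ S, ∀ x ∈ D, p x (s x)) : ∃ s ∈ S, ∀ x, p x (s x) := by
  obtain ⟨s, hs, hp⟩ := hS.isCompact.inter_iInter_nonempty
    (fun x => {s : G → A | p x (s x)})
    (fun x => (isClosed_discrete {a | p x a}).preimage (continuous_apply x))
    (fun D => by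
      obtain ⟨s, hs, hp⟩ := h D
      exact ⟨s, hs, by simpa using hp⟩)
  exact ⟨s, hs, by simpa using hp⟩

theorem exists_finset_forall_mem_of_isOpen {G A : Type*} [TopologicalSpace A]
    {U : Set (G → A)} (hU : IsOpen U) {s : G → A} (hs : s ∈ U) :
    ∃ D : Finset G, ∀ c : G → A, (∀ x ∈ D, c x = s x) → c ∈ U := by
  obtain ⟨D, u, hu, hsub⟩ := isOpen_pi_iff.1 hU s hs
  exact ⟨D, fun c hcs => hsub fun x hx => by rw [hcs x hx]; exact (hu x hx).2⟩

theorem mem_closure_iff_forall_finset {G A : Type*} [TopologicalSpace A]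
    [DiscreteTopology A] {C : Set (G → A)} {s : G → A} :
    s ∈ closure C ↔ ∀ D : Finset G, ∃ c ∈ C, ∀ x ∈ D, c x = s x := by
  constructor
  · intro h D
    obtain ⟨c, hc, hcC⟩ := mem_closure_iff.1 h (Set.pi D fun x => {s x})
      (isOpen_set_pi D.finite_toSet fun _ _ => isOpen_discrete _) (by simp [Set.mem_pi])
    exact ⟨c, hcC, fun x hx => hc x hx⟩
  · intro h
    refine mem_closure_iff.2 fun U hU hs => ?_
    obtain ⟨D, hD⟩ := exists_finset_forall_mem_of_isOpen hU hs
    obtain ⟨c, hc, hcs⟩ := h D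
    exact ⟨c, hD c hcs, hc⟩

theorem IsGluing.closure {G A : Type*} [Group G] [Finite A] [TopologicalSpace A]
    [DiscreteTopology A] {X : Set G} {S : Set (G → A)} (h : IsGluing X S) :
    IsGluing X (closure S) := by
  intro E₁ E₂ hE s₁ h₁ s₂ h₂
  obtain ⟨s, hs, hp⟩ := exists_mem_forall_of_finset (isClosed_closure (s := S))
    (fun x a => (x ∈ E₁ → a = s₁ x) ∧ (x ∈ E₂ → a = s₂ x)) (fun D => by
      obtain ⟨c₁, hc₁, e₁⟩ := mem_closure_iff_forall_finset.1 h₁ D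
      obtain ⟨c₂, hc₂, e₂⟩ := mem_closure_iff_forall_finset.1 h₂ D
      obtain ⟨c, hc, e₁', e₂'⟩ := h E₁ E₂ hE c₁ hc₁ c₂ hc₂
      exact ⟨c, subset_closure hc, fun x hx => ⟨fun hx₁ => (e₁' x hx₁).trans (e₁ x hx),
        fun hx₂ => (e₂' x hx₂).trans (e₂ x hx)⟩⟩)
  exact ⟨s, hs, fun x hx => (hp x).1 hx, fun x hx => (hp x).2 hx⟩

theorem shiftAct_mem_closure {G A : Type*} [Group G] [TopologicalSpace A]
    {S : Set (G → A)} (hS : ∀ s ∈ S, ∀ g : G, shiftAct g s ∈ S) :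
    ∀ s ∈ closure S, ∀ g : G, shiftAct g s ∈ closure S := fun _ hs g =>
  map_mem_closure (f := shiftAct g) (continuous_pi fun _ => continuous_apply _) hs
    fun s hs => hS s hs g

open scoped Classical in
theorem IsGluing.exists_glue_family {G A ι : Type*} [Group G] [Finite A] [TopologicalSpace A]
    [DiscreteTopology A] {X : Set G} {S : Set (G → A)} (h : IsGluing X S) (hS : IsClosed S)
    (hne : S.Nonempty) (E : ι → Set G) (hE : Pairwise fun i j => Disjoint (E i * X) (E j * X))
    (s : ι → G → A) (hs : ∀ i, s i ∈ S) : ∃ t ∈ S, ∀ i, ∀ x ∈ E i, t x = s i x := by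
  have hfin : ∀ I : Finset ι, ∃ t ∈ S, ∀ i ∈ I, ∀ x ∈ E i, t x = s i x := by
    intro I
    induction I using Finset.induction_on with
    | empty => exact hne.imp fun t ht => ⟨ht, by simp⟩
    | insert j I hj ih =>
      obtain ⟨t, ht, htI⟩ := ih
      obtain ⟨t', ht', h₁, h₂⟩ := h (⋃ i ∈ I, E i) (E j) (by
        simp only [Set.iUnion_mul, Set.disjoint_iUnion_left]
        intro i hi
        exact hE (by rintro rfl; exact hj hi)) t ht (s j) (hs j)
      refine ⟨t', ht', fun i hi x hx => ?_⟩
      rcases Finset.mem_insert.1 hi with rfl | hi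
      · exact h₂ x hx
      · rw [h₁ x (Set.mem_biUnion hi hx), htI i hi x hx]
  obtain ⟨t, ht, hp⟩ := hS.isCompact.inter_iInter_nonempty
    (fun i => {t : G → A | ∀ x ∈ E i, t x = s i x})
    (fun i => by
      simp only [Set.ofPred_forall]
      exact isClosed_iInter fun x => isClosed_iInter fun _ =>
        isClosed_eq (continuous_apply x) continuous_const)
    (fun I => by
      obtain ⟨t, ht, hp⟩ := hfin I
      exact ⟨t, ht, by simpa using hp⟩)
  exact ⟨t, ht, by simpa using hp⟩

open scoped Classical in
theorem exists_separated_family {G ι : Type*} [Group G] [Infinite G] [Finite ι] (K : Finset G) :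
    ∃ g : ι → G, Pairwise fun i j => (g i)⁻¹ * g j ∉ K := by
  have : Std.Symm fun a b : G => a⁻¹ * b ∉ K ∪ K⁻¹ := ⟨fun a b hab hba => hab (by
    have : a⁻¹ * b = (b⁻¹ * a)⁻¹ := by group
    rw [this]
    rcases Finset.mem_union.1 hba with h | h
    · exact Finset.mem_union_right _ (Finset.inv_mem_inv h)
    · exact Finset.mem_union_left _ (Finset.mem_inv'.1 h))⟩
  obtain ⟨f, -, hf⟩ := exists_seq_of_forall_finset_exists' (fun _ : G => True)
    (fun a b => a⁻¹ * b ∉ K ∪ K⁻¹) (fun s _ => by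
      obtain ⟨y, hy⟩ := Infinite.exists_notMem_finset (s * (K ∪ K⁻¹))
      refine ⟨y, trivial, fun x hx hxy => hy ?_⟩
      simpa using Finset.mul_mem_mul hx hxy)
  obtain ⟨n, ⟨eqv⟩⟩ := Finite.exists_equiv_fin ι
  refine ⟨fun i => f (eqv i), fun i j hij hK => ?_⟩
  exact hf (show (eqv i : ℕ) ≠ eqv j from fun h => hij (eqv.injective (Fin.ext h)))
    (Finset.mem_union_left _ hK)

open scoped Classical in
/-- A strongly irreducible shift has a configuration in which all of its `F`-patterns occur at
positions from a fixed finite set. -/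
theorem IsGluing.exists_rich {G A : Type*} [Group G] [Infinite G] [Finite A] [TopologicalSpace A]
    [DiscreteTopology A] {X : Finset G} {S : Set (G → A)} (h : IsGluing (X : Set G) S)
    (hS : IsShift S) (F : Finset G) :
    ∃ s₀ ∈ S, ∃ H : Finset G, ∀ t ∈ S, ∃ g ∈ H, ∀ x ∈ F, s₀ (g * x) = t x := by
  obtain ⟨s₁, hs₁⟩ := hS.1
  have hrep : ∀ φ : F → A, ∃ u ∈ S, ∀ t ∈ S, (∀ x : F, t x = φ x) → ∀ x : F, u x = φ x := by
    intro φ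
    by_cases hφ : ∃ t ∈ S, ∀ x : F, t x = φ x
    · obtain ⟨t, ht, htφ⟩ := hφ
      exact ⟨t, ht, fun _ _ _ => htφ⟩
    · exact ⟨s₁, hs₁, fun t ht htφ => (hφ ⟨t, ht, htφ⟩).elim⟩
  choose u huS hu using hrep
  obtain ⟨g, hg⟩ := exists_separated_family (ι := F → A) ((F * X) * (F * X)⁻¹)
  have := Fintype.ofFinite (F → A)
  obtain ⟨s₀, hs₀, he⟩ := h.exists_glue_family hS.2.1 hS.1 (fun φ => g φ • (F : Set G))
    (fun φ ψ hφψ => by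
      refine Set.disjoint_left.2 ?_
      rintro _ ⟨_, ⟨a, ha, rfl⟩, x, hx, rfl⟩ ⟨_, ⟨b, hb, rfl⟩, y, hy, hxy⟩
      refine hg hφψ ?_
      simp only [smul_eq_mul] at hxy
      have : (g φ)⁻¹ * g ψ = (a * x) * (b * y)⁻¹ := by
        calc (g φ)⁻¹ * g ψ = (g φ)⁻¹ * (g ψ * b * y) * (b * y)⁻¹ := by group
          _ = _ := by rw [hxy]; group
      rw [this]
      exact Finset.mul_mem_mul (Finset.mul_mem_mul ha hx)
        (Finset.inv_mem_inv (Finset.mul_mem_mul hb hy)))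
    (fun φ => shiftAct (g φ) (u φ)) (fun φ => hS.2.2 _ (huS φ) _)
  refine ⟨s₀, hs₀, Finset.univ.image g, fun t ht => ?_⟩
  refine ⟨g fun x => t x, Finset.mem_image_of_mem _ (Finset.mem_univ _), fun x hx => ?_⟩
  refine (he (fun x => t x) _ (Set.smul_mem_smul_set hx)).trans ?_
  simpa [shiftAct] using hu (fun x => t x) t ht (fun _ => rfl) ⟨x, hx⟩

/-- Any two configurations of `S` agree on `g * F`, and every `F`-pattern of `S` occurs at a
position `g`, for some `g` in a fixed finite set. -/
def HasWindow {G A : Type*} [Group G] (F : Set G) (S : Set (G → A)) : Prop :=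
  ∃ B : Finset G, ∀ s ∈ S, ∀ t ∈ S, (∃ g ∈ B, ∀ x ∈ F, s (g * x) = t (g * x)) ∧
    ∃ g ∈ B, ∀ x ∈ F, s (g * x) = t x

open scoped Classical in
theorem HasWindow.exists_agreeOn {G A : Type*} [Group G] {F : Finset G} {S : Set (G → A)}
    (h : HasWindow (F : Set G) S) :
    ∃ D : Finset G, ∀ T, AgreeOn (D : Set G) S T → HasWindow (F : Set G) T := by
  obtain ⟨B, hB⟩ := h
  refine ⟨F ∪ B * F, fun T hT => ⟨B, fun s hs t ht => ?_⟩⟩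
  obtain ⟨s', hs', e⟩ := (hT s).2 ⟨s, hs, fun _ _ => rfl⟩
  obtain ⟨t', ht', e'⟩ := (hT t).2 ⟨t, ht, fun _ _ => rfl⟩
  have hmem : ∀ g ∈ B, ∀ x ∈ F, g * x ∈ F ∪ B * F := fun g hg x hx =>
    Finset.mem_union_right _ (Finset.mul_mem_mul hg hx)
  obtain ⟨⟨g, hg, h₁⟩, k, hk, h₂⟩ := hB s' hs' t' ht'
  refine ⟨⟨g, hg, fun x hx => ?_⟩, k, hk, fun x hx => ?_⟩
  · rw [← e _ (hmem g hg x hx), ← e' _ (hmem g hg x hx), h₁ x hx]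
  · rw [← e _ (hmem k hk x hx), ← e' _ (Finset.mem_union_left _ hx), h₂ x hx]

theorem agreeOn_closure {G A : Type*} [TopologicalSpace A] [DiscreteTopology A] (D : Finset G)
    (S : Set (G → A)) : AgreeOn (D : Set G) S (closure S) := by
  refine fun p => ⟨fun ⟨s, hs, he⟩ => ⟨s, subset_closure hs, he⟩, fun ⟨s, hs, he⟩ => ?_⟩
  obtain ⟨c, hc, hcs⟩ := mem_closure_iff_forall_finset.1 hs D
  exact ⟨c, hc, fun x hx => (hcs x hx).trans (he x hx)⟩

theorem HasWindow.closure {G A : Type*} [Group G] [TopologicalSpace A]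
    [DiscreteTopology A] {F : Finset G} {S : Set (G → A)} (h : HasWindow (F : Set G) S) :
    HasWindow (F : Set G) (closure S) := by
  obtain ⟨D, hD⟩ := h.exists_agreeOn
  exact hD _ (agreeOn_closure D S)

open scoped Classical in
/-- Over an ICC group, every strongly irreducible shift agrees on any finite `F` with a strongly
irreducible subshift with an `F`-window. -/
theorem IsICC.exists_hasWindow {G A : Type*} [Group G] (hG : IsICC G) [Finite A]
    [TopologicalSpace A] [DiscreteTopology A] {S : Set (G → A)} (hS : IsShift S)
    (hSI : StronglyIrreducible S) (F : Finset G) :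
    ∃ S' : Set (G → A), IsShift S' ∧ StronglyIrreducible S' ∧ AgreeOn (F : Set G) S S' ∧
      HasWindow (F : Set G) S' := by
  have := hG.infinite
  obtain ⟨X, hX1, hX⟩ := stronglyIrreducible_iff.1 hSI
  obtain ⟨s₀, hs₀, H, hH⟩ := hX.exists_rich hS F
  let P : Finset G := insert 1 H * insert 1 F
  let Q : Finset G := (P * X) * (P * X)⁻¹
  have hP1 : (1 : G) ∈ P := by
    simpa using Finset.mul_mem_mul (Finset.mem_insert_self 1 H) (Finset.mem_insert_self 1 F)
  have hQ' : ∀ p ∈ P, ∀ x ∈ X, ∀ p' ∈ P, ∀ x' ∈ X, p * x * (p' * x')⁻¹ ∈ Q :=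
    fun p hp x hx p' hp' x' hx' => Finset.mul_mem_mul (Finset.mul_mem_mul hp hx)
      (Finset.inv_mem_inv (Finset.mul_mem_mul hp' hx'))
  obtain ⟨𝒩, ⟨N₀, hN₀⟩, hinv, hsep, ⟨Y, hY⟩, B, hB⟩ := hG.exists_intersecting_family Q
    (by simpa using hQ' 1 hP1 1 hX1 1 hP1 1 hX1)
    (by
      intro q hq
      obtain ⟨a, ha, b, hb, rfl⟩ := Finset.mem_mul.1 hq
      simpa [Q] using Finset.mul_mem_mul (Finset.mem_inv'.1 hb) (Finset.inv_mem_inv ha))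
  have hfar : ∀ N ∈ 𝒩, ∀ g ∈ N, ∀ h ∈ N, g ≠ h →
      Disjoint ((g • (P : Set G)) * (X : Set G)) ((h • (P : Set G)) * (X : Set G)) := by
    intro N hN g hg h hh hgh
    refine Set.disjoint_left.2 ?_
    rintro _ ⟨_, ⟨a, ha, rfl⟩, x, hx, rfl⟩ ⟨_, ⟨b, hb, rfl⟩, y, hy, hxy⟩
    refine hgh (hsep N hN g hg h hh ?_)
    simp only [smul_eq_mul] at hxy
    have : g⁻¹ * h = (a * x) * (b * y)⁻¹ := by
      calc g⁻¹ * h = g⁻¹ * (h * b * y) * (b * y)⁻¹ := by group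
        _ = _ := by rw [hxy]; group
    rw [this]
    exact hQ' a ha x hx b hb y hy
  have hplace : ∀ N ∈ 𝒩, ∃ s ∈ S, ∀ g ∈ N, ∀ x ∈ P, s (g * x) = s₀ x := by
    intro N hN
    obtain ⟨s, hs, he⟩ := hX.exists_glue_family hS.2.1 hS.1 (fun g : N => (g : G) • (P : Set G))
      (fun g h hgh => hfar N hN g g.2 h h.2 (fun e => hgh (Subtype.ext e)))
      (fun g => shiftAct (g : G) s₀) (fun g => hS.2.2 _ hs₀ _)
    refine ⟨s, hs, fun g hg x hx => ?_⟩
    refine (he ⟨g, hg⟩ _ (Set.smul_mem_smul_set hx)).trans ?_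
    simp [shiftAct]
  let S₀ : Set (G → A) := {s | s ∈ S ∧ ∃ N ∈ 𝒩, ∀ g ∈ N, ∀ x ∈ P, s (g * x) = s₀ x}
  have hne : S₀.Nonempty := by
    obtain ⟨s, hs, he⟩ := hplace N₀ hN₀
    exact ⟨s, hs, N₀, hN₀, he⟩
  have hS₀inv : ∀ s ∈ S₀, ∀ g : G, shiftAct g s ∈ S₀ := by
    rintro s ⟨hs, N, hN, he⟩ k
    refine ⟨hS.2.2 s hs k, k • N, hinv N hN k, fun g hg x hx => ?_⟩
    have := he _ (Set.mem_smul_set_iff_inv_smul_mem.1 hg) x hx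
    simpa [shiftAct, mul_assoc] using this
  have hwin : HasWindow (F : Set G) S₀ := by
    refine ⟨B ∪ B * H, ?_⟩
    rintro s ⟨hs, N, hN, he⟩ t ⟨ht, N', hN', he'⟩
    obtain ⟨g, hg, hgN, hgN'⟩ := hB N hN N' hN'
    refine ⟨⟨g, Finset.mem_union_left _ hg, fun x hx => ?_⟩, ?_⟩
    · have hxP : x ∈ P := by
        simpa using Finset.mul_mem_mul (Finset.mem_insert_self 1 H) (Finset.mem_insert_of_mem hx)
      rw [he g hgN x hxP, he' g hgN' x hxP]
    · obtain ⟨h, hh, hht⟩ := hH t ht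
      refine ⟨g * h, Finset.mem_union_right _ (Finset.mul_mem_mul hg hh), fun x hx => ?_⟩
      rw [mul_assoc, he g hgN _ (Finset.mul_mem_mul (Finset.mem_insert_of_mem hh)
        (Finset.mem_insert_of_mem hx)), hht x hx]
  let C : Set G := (X : Set G) * (X : Set G)⁻¹ * (P : Set G)⁻¹
  have hglue : IsGluing ((X : Set G) ∪ C * P * X ∪ C * Y) S₀ := by
    rintro E₁ E₂ hE s₁ ⟨hs₁, N₁, hN₁, he₁⟩ s₂ ⟨hs₂, N₂, hN₂, he₂⟩
    obtain ⟨N, hN, hNN₁, hNN₂⟩ := hY (E₁ * C) (E₂ * C)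
      (hE.mono (by rw [mul_assoc]; exact Set.mul_subset_mul_left Set.subset_union_right)
        (by rw [mul_assoc]; exact Set.mul_subset_mul_left Set.subset_union_right)) N₁ hN₁ N₂ hN₂
    obtain ⟨s₃, hs₃, he₃⟩ := hplace N hN
    let near : Set G → Set G := fun E =>
      {g | g ∈ N ∧ ¬ Disjoint ((g • (P : Set G)) * (X : Set G)) (E * (X : Set G))}
    let fat : Set G → Set G := fun E => E ∪ near E * (P : Set G)
    have hnear : ∀ E, near E ⊆ E * C := by
      rintro E g ⟨-, hg⟩
      obtain ⟨_, ⟨_, ⟨p, hp, rfl⟩, x, hx, rfl⟩, a, ha, y, hy, hxy⟩ := Set.not_disjoint_iff.1 hg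
      refine ⟨a, ha, y * x⁻¹ * p⁻¹, Set.mul_mem_mul (Set.mul_mem_mul hy
        (Set.inv_mem_inv.2 hx)) (Set.inv_mem_inv.2 hp), ?_⟩
      simp only [smul_eq_mul] at hxy ⊢
      rw [← mul_assoc, ← mul_assoc, hxy]
      group
    have hfat : ∀ E, fat E * (X : Set G) ⊆ E * ((X : Set G) ∪ C * P * X ∪ C * Y) := by
      intro E
      rw [Set.union_mul]
      refine Set.union_subset (Set.mul_subset_mul_left
        (Set.subset_union_left.trans Set.subset_union_left)) ?_
      refine (Set.mul_subset_mul_right (Set.mul_subset_mul_right (hnear E))).trans ?_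
      rw [mul_assoc, mul_assoc, ← mul_assoc C]
      exact Set.mul_subset_mul_left (Set.subset_union_right.trans Set.subset_union_left)
    have hrest : ∀ E, Disjoint (fat E * (X : Set G))
        ({g | g ∈ N ∧ g ∉ near E} * (P : Set G) * (X : Set G)) := by
      intro E
      refine Set.disjoint_right.2 ?_
      rintro _ ⟨_, ⟨g, ⟨hgN, hg⟩, p, hp, rfl⟩, x, hx, rfl⟩ ⟨_, hz | ⟨k, hk, p', hp', rfl⟩, y, hy, hzy⟩
      · refine hg ⟨hgN, Set.not_disjoint_iff.2 ⟨_, Set.mul_mem_mul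
          (Set.smul_mem_smul_set hp) hx, _, hz, y, hy, hzy⟩⟩
      · refine Set.disjoint_left.1 (hfar N hN g hgN k hk.1 (by rintro rfl; exact hg hk))
          (Set.mul_mem_mul (Set.smul_mem_smul_set hp) hx) ?_
        exact ⟨_, Set.smul_mem_smul_set hp', y, hy, hzy⟩
    obtain ⟨t, ht, ht₁, ht₂⟩ := hX (fat E₁) (fat E₂) (hE.mono (hfat E₁) (hfat E₂)) s₁ hs₁ s₂ hs₂
    obtain ⟨u, hu, hut, hu₃⟩ := hX (fat E₁ ∪ fat E₂)
      ({g | g ∈ N ∧ g ∉ near E₁ ∧ g ∉ near E₂} * (P : Set G)) (by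
        rw [Set.union_mul, Set.disjoint_union_left]
        constructor
        · refine (hrest E₁).mono_right (Set.mul_subset_mul_right (Set.mul_subset_mul_right ?_))
          exact fun g hg => ⟨hg.1, hg.2.1⟩
        · refine (hrest E₂).mono_right (Set.mul_subset_mul_right (Set.mul_subset_mul_right ?_))
          exact fun g hg => ⟨hg.1, hg.2.2⟩) t ht s₃ hs₃
    refine ⟨u, ⟨hu, N, hN, fun g hg x hx => ?_⟩, fun a ha => ?_, fun a ha => ?_⟩
    · by_cases h₁ : g ∈ near E₁
      · have hm : g * x ∈ fat E₁ := Or.inr (Set.mul_mem_mul h₁ hx)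
        rw [hut _ (Or.inl hm), ht₁ _ hm, he₁ g ((hNN₁ g (hnear _ h₁)).1 hg) x hx]
      by_cases h₂ : g ∈ near E₂
      · have hm : g * x ∈ fat E₂ := Or.inr (Set.mul_mem_mul h₂ hx)
        rw [hut _ (Or.inr hm), ht₂ _ hm, he₂ g ((hNN₂ g (hnear _ h₂)).1 hg) x hx]
      rw [hu₃ _ (Set.mul_mem_mul ⟨hg, h₁, h₂⟩ hx), he₃ g hg x hx]
    · rw [hut _ (Or.inl (Or.inl ha)), ht₁ _ (Or.inl ha)]
    · rw [hut _ (Or.inr (Or.inl ha)), ht₂ _ (Or.inl ha)]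
  have hsub : closure S₀ ⊆ S := hS.2.1.closure_subset_iff.2 fun s hs => hs.1
  refine ⟨closure S₀, ⟨hne.closure, isClosed_closure, shiftAct_mem_closure hS₀inv⟩,
    stronglyIrreducible_iff.2 ⟨X ∪ X * X⁻¹ * P⁻¹ * P * X ∪ X * X⁻¹ * P⁻¹ * Y,
      by simp [hX1], ?_⟩, ?_, hwin.closure⟩
  · simpa [C, Set.union_assoc] using hglue.closure
  · intro p
    refine ⟨?_, fun ⟨s, hs, he⟩ => ⟨s, hsub hs, he⟩⟩
    rintro ⟨t, ht, he⟩
    obtain ⟨s, hs, N, hN, hse⟩ := hne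
    obtain ⟨g, -, hgN, -⟩ := hB N hN N hN
    obtain ⟨h, hh, hht⟩ := hH t ht
    refine ⟨shiftAct (g * h)⁻¹ s, subset_closure (hS₀inv s ⟨hs, N, hN, hse⟩ _), fun x hx => ?_⟩
    rw [← he x hx, ← hht x hx, ← hse g hgN _ (Finset.mul_mem_mul (Finset.mem_insert_of_mem hh)
        (Finset.mem_insert_of_mem hx))]
    simp [shiftAct, mul_assoc]

open scoped Classical in
theorem IsICC.faithfulShift {G A : Type*} [Group G] (hG : IsICC G) {S : Set (G → A)}
    (hSI : StronglyIrreducible S) (hS : ∃ s ∈ S, ∃ t ∈ S, s ≠ t)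
    (hinv : ∀ s ∈ S, ∀ g : G, shiftAct g s ∈ S) : FaithfulShift S := by
  intro g hg
  obtain ⟨X, -, hX⟩ := stronglyIrreducible_iff.1 hSI
  obtain ⟨s, hs, t, ht, hst⟩ := hS
  obtain ⟨a, ha⟩ := Function.ne_iff.1 hst
  have hg' : g⁻¹ ≠ 1 := inv_ne_one.2 hg
  obtain ⟨c, hc, hcX⟩ := (hG.2 _ hg').exists_notMem_finset (X * X⁻¹)
  obtain ⟨k, rfl⟩ := isConj_iff.1 (show IsConj g⁻¹ c from hc)
  obtain ⟨u, hu, hu₁, hu₂⟩ := hX {k⁻¹} {g⁻¹ * k⁻¹} (by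
    refine Set.disjoint_left.2 ?_
    rintro _ ⟨_, rfl, x, hx, rfl⟩ ⟨_, rfl, y, hy, hxy⟩
    refine hcX (Finset.mem_mul.2 ⟨x, hx, y⁻¹, Finset.inv_mem_inv hy, ?_⟩)
    simp only at hxy
    have : x = k * (g⁻¹ * k⁻¹ * y) := by rw [hxy]; group
    rw [this]
    group)
    (shiftAct (k⁻¹ * a⁻¹) s) (hinv _ hs _) (shiftAct (g⁻¹ * k⁻¹ * a⁻¹) t) (hinv _ ht _)
  refine ⟨u, hu, fun he => ha ?_⟩
  have h₁ := hu₁ _ rfl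
  have h₂ := hu₂ _ rfl
  have h₃ := congrFun he k⁻¹
  simp only [shiftAct] at h₁ h₂ h₃
  have h₄ := h₁.symm.trans (h₃.symm.trans h₂)
  convert h₄ using 2 <;> group

theorem AgreeOn.refl {G A : Type*} (F : Set G) (S : Set (G → A)) : AgreeOn F S S :=
  fun _ => Iff.rfl

theorem AgreeOn.symm {G A : Type*} {F : Set G} {S T : Set (G → A)} (h : AgreeOn F S T) :
    AgreeOn F T S := fun p => (h p).symm

theorem AgreeOn.trans {G A : Type*} {F : Set G} {S T U : Set (G → A)} (h : AgreeOn F S T)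
    (h' : AgreeOn F T U) : AgreeOn F S U := fun p => (h p).trans (h' p)

theorem AgreeOn.exists_mem {G A : Type*} {F : Set G} {S T : Set (G → A)} (h : AgreeOn F S T)
    {s : G → A} (hs : s ∈ S) : ∃ t ∈ T, ∀ x ∈ F, t x = s x :=
  (h s).1 ⟨s, hs, fun _ _ => rfl⟩

theorem AgreeOn.mono {G A : Type*} {F F' : Set G} {S T : Set (G → A)} (h : AgreeOn F S T)
    (hF : F' ⊆ F) : AgreeOn F' S T := by
  have aux : ∀ {S T : Set (G → A)}, AgreeOn F S T → ∀ p : G → A,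
      (∃ s ∈ S, ∀ x ∈ F', s x = p x) → ∃ t ∈ T, ∀ x ∈ F', t x = p x := by
    rintro S T h p ⟨s, hs, he⟩
    obtain ⟨t, ht, hts⟩ := h.exists_mem hs
    exact ⟨t, ht, fun x hx => (hts x (hF hx)).trans (he x hx)⟩
  exact fun p => ⟨aux h p, aux h.symm p⟩

open scoped Classical in
/-- The first `n` elements of the enumeration `e`. -/
noncomputable def window {G : Type*} (e : ℕ → G) (n : ℕ) : Finset G :=
  (Finset.range n).image e

theorem coe_window {G : Type*} (e : ℕ → G) (n : ℕ) :
    (window e n : Set G) = {g : G | ∃ k < n, e k = g} := by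
  ext
  simp [window]

theorem window_mono {G : Type*} (e : ℕ → G) : Monotone (window e) := fun _ _ h => by
  classical exact Finset.image_subset_image (Finset.range_subset_range.2 h)

theorem exists_subset_window {G : Type*} {e : ℕ → G} (he : Function.Surjective e)
    (D : Finset G) : ∃ n, D ⊆ window e n := by
  classical
  choose f hf using he
  refine ⟨D.sup f + 1, fun x hx => ?_⟩
  exact Finset.mem_image.2 ⟨f x, Finset.mem_range.2 (Nat.lt_succ_of_le (Finset.le_sup hx)), hf x⟩

theorem eq_of_forall_agreeOn_window {G A : Type*} [Group G] [TopologicalSpace A]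
    [DiscreteTopology A] {e : ℕ → G} (he : Function.Surjective e) {S T : ShiftSpace G A}
    (h : ∀ n, AgreeOn (window e n : Set G) S.1 T.1) : S = T := by
  have aux : ∀ {S T : ShiftSpace G A}, (∀ n, AgreeOn (window e n : Set G) S.1 T.1) →
      S.1 ⊆ T.1 := by
    intro S T h s hs
    rw [← T.2.2.1.closure_eq]
    refine mem_closure_iff_forall_finset.2 fun D => ?_
    obtain ⟨n, hn⟩ := exists_subset_window he D
    exact ((h n).mono (Finset.coe_subset.2 hn)).exists_mem hs
  exact Subtype.ext ((aux h).antisymm (aux fun n => (h n).symm))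

theorem exists_shiftSpaceDist_eq {G A : Type*} [Group G] [TopologicalSpace A]
    [DiscreteTopology A] {e : ℕ → G} (he : Function.Surjective e) {S T : ShiftSpace G A}
    (hST : S ≠ T) : ∃ k : ℕ, shiftSpaceDist e S T = 1 / ((k : ℝ) + 1) ∧
      ∀ n, AgreeOn (window e n : Set G) S.1 T.1 ↔ n ≤ k := by
  have hne : ∃ n, ¬ AgreeOn (window e n : Set G) S.1 T.1 := by
    by_contra! h
    exact hST (eq_of_forall_agreeOn_window he h)
  obtain ⟨N, hN⟩ := hne
  have hmono : ∀ {n k : ℕ}, n ≤ k → AgreeOn (window e k : Set G) S.1 T.1 →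
      AgreeOn (window e n : Set G) S.1 T.1 := fun hnk h =>
    h.mono (Finset.coe_subset.2 (window_mono e hnk))
  have hbdd : BddAbove {n : ℕ | AgreeOn (window e n : Set G) S.1 T.1} :=
    ⟨N, fun n hn => le_of_not_gt fun h => hN (hmono h.le hn)⟩
  have h0 : AgreeOn (window e 0 : Set G) S.1 T.1 := fun p => by
    simp [window, show ∃ x, x ∈ S.1 from S.2.1, show ∃ x, x ∈ T.1 from T.2.1]
  refine ⟨sSup {n : ℕ | AgreeOn (window e n : Set G) S.1 T.1}, ?_, fun n =>
    ⟨fun h => le_csSup hbdd h, fun h => hmono h (Nat.sSup_mem ⟨0, h0⟩ hbdd)⟩⟩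
  simp only [shiftSpaceDist, hST, if_false, coe_window]

theorem agreeOn_of_shiftSpaceDist_lt {G A : Type*} [Group G] [TopologicalSpace A]
    [DiscreteTopology A] {e : ℕ → G} (he : Function.Surjective e) {S T : ShiftSpace G A} {n : ℕ}
    (h : shiftSpaceDist e S T < 1 / ((n : ℝ) + 1)) : AgreeOn (window e n : Set G) S.1 T.1 := by
  by_cases hST : S = T
  · rw [hST]
    exact AgreeOn.refl _ _
  · obtain ⟨k, hk, hiff⟩ := exists_shiftSpaceDist_eq he hST
    rw [hk, one_div_lt_one_div (by positivity) (by positivity)] at h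
    refine (hiff n).2 ?_
    exact_mod_cast (lt_of_add_lt_add_right h).le

theorem shiftSpaceDist_le_of_agreeOn {G A : Type*} [Group G] [TopologicalSpace A]
    [DiscreteTopology A] {e : ℕ → G} (he : Function.Surjective e) {S T : ShiftSpace G A} {n : ℕ}
    (h : AgreeOn (window e n : Set G) S.1 T.1) : shiftSpaceDist e S T ≤ 1 / ((n : ℝ) + 1) := by
  by_cases hST : S = T
  · simp only [shiftSpaceDist, hST, if_true]
    positivity
  · obtain ⟨k, hk, hiff⟩ := exists_shiftSpaceDist_eq he hST
    rw [hk]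
    have : (n : ℝ) ≤ k := by exact_mod_cast (hiff n).1 h
    exact one_div_le_one_div_of_le (by positivity) (by linarith)

theorem isOpen_shiftSpaceTopology_iff {G A : Type*} [Group G] [TopologicalSpace A]
    [DiscreteTopology A] {e : ℕ → G} (he : Function.Surjective e) {U : Set (ShiftSpace G A)} :
    @IsOpen _ (shiftSpaceTopology G A e) U ↔
      ∀ S ∈ U, ∃ n, ∀ T : ShiftSpace G A, AgreeOn (window e n : Set G) S.1 T.1 → T ∈ U := by
  constructor
  · intro hU
    induction hU with
    | basic V hV =>
      obtain ⟨S₀, ε, hε, rfl⟩ := hV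
      intro S hS
      by_cases hne : S₀ = S
      · subst hne
        obtain ⟨n, hn⟩ := exists_nat_one_div_lt hε
        exact ⟨n, fun T hT => (shiftSpaceDist_le_of_agreeOn he hT).trans_lt hn⟩
      · obtain ⟨k, hk, hiff⟩ := exists_shiftSpaceDist_eq he hne
        refine ⟨k, fun T hT => ?_⟩
        have hlt : shiftSpaceDist e S₀ S < ε := hS
        rw [hk] at hlt
        exact (shiftSpaceDist_le_of_agreeOn he (((hiff k).2 le_rfl).trans hT)).trans_lt hlt
    | univ => exact fun _ _ => ⟨0, fun _ _ => trivial⟩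
    | inter V W _ _ hV hW =>
      rintro S ⟨hSV, hSW⟩
      obtain ⟨n, hn⟩ := hV S hSV
      obtain ⟨k, hk⟩ := hW S hSW
      exact ⟨max n k, fun T hT =>
        ⟨hn T (hT.mono (Finset.coe_subset.2 (window_mono e (le_max_left n k)))),
          hk T (hT.mono (Finset.coe_subset.2 (window_mono e (le_max_right n k))))⟩⟩
    | sUnion c _ hc =>
      rintro S ⟨V, hVc, hSV⟩
      obtain ⟨n, hn⟩ := hc V hVc S hSV
      exact ⟨n, fun T hT => ⟨V, hVc, hn T hT⟩⟩
  · intro h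
    let _ := shiftSpaceTopology G A e
    refine isOpen_iff_forall_mem_open.2 fun S hS => ?_
    obtain ⟨n, hn⟩ := h S hS
    refine ⟨{T | shiftSpaceDist e S T < 1 / ((n : ℝ) + 1)},
      fun T hT => hn T (agreeOn_of_shiftSpaceDist_lt he hT),
      TopologicalSpace.isOpen_generateFrom_of_mem ⟨S, _, by positivity, rfl⟩, ?_⟩
    simp only [Set.mem_ofPred_eq, shiftSpaceDist, if_true]
    positivity

theorem mem_closure_shiftSpaceTopology_iff {G A : Type*} [Group G] [TopologicalSpace A]
    [DiscreteTopology A] {e : ℕ → G} (he : Function.Surjective e) {C : Set (ShiftSpace G A)}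
    {S : ShiftSpace G A} : S ∈ @closure _ (shiftSpaceTopology G A e) C ↔
      ∀ n, ∃ T ∈ C, AgreeOn (window e n : Set G) S.1 T.1 := by
  let _ := shiftSpaceTopology G A e
  rw [mem_closure_iff]
  constructor
  · intro h n
    obtain ⟨T, hT, hTC⟩ := h {T | AgreeOn (window e n : Set G) S.1 T.1}
      ((isOpen_shiftSpaceTopology_iff he).2 fun T hT => ⟨n, fun U hU => hT.trans hU⟩)
      (AgreeOn.refl _ _)
    exact ⟨T, hTC, hT⟩
  · intro h U hU hSU
    obtain ⟨n, hn⟩ := (isOpen_shiftSpaceTopology_iff he).1 hU S hSU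
    obtain ⟨T, hTC, hT⟩ := h n
    exact ⟨T, hn T hT, hTC⟩

open scoped Classical in
/-- A sequence of shifts that stabilizes on an exhausting sequence of windows has a limit. -/
theorem exists_shift_forall_agreeOn {G A : Type*} [Group G] [Finite A] [TopologicalSpace A]
    [DiscreteTopology A] {e : ℕ → G} (he : Function.Surjective e) (S : ℕ → ShiftSpace G A)
    (m : ℕ → ℕ) (hm : StrictMono m)
    (h : ∀ n, AgreeOn (window e (m n) : Set G) (S n).1 (S (n + 1)).1) :
    ∃ T : ShiftSpace G A, ∀ n, AgreeOn (window e (m n) : Set G) (S n).1 T.1 := by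
  have hW : ∀ {j n}, j ≤ n → (window e (m j) : Set G) ⊆ window e (m n) := fun hjn =>
    Finset.coe_subset.2 (window_mono e (hm.monotone hjn))
  have hchain : ∀ {j n}, j ≤ n → AgreeOn (window e (m j) : Set G) (S j).1 (S n).1 := by
    intro j n hjn
    induction n, hjn using Nat.le_induction with
    | base => exact AgreeOn.refl _ _
    | succ n hjn ih => exact ih.trans ((h n).mono (hW hjn))
  let C : ℕ → Set (G → A) := fun n => {s | ∃ t ∈ (S n).1, ∀ x ∈ window e (m n), t x = s x}
  have hSC : ∀ {j n}, j ≤ n → (S n).1 ⊆ C j := fun hjn s hs => (hchain hjn).symm.exists_mem hs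
  have hCcl : ∀ n, IsClosed (C n) := by
    refine fun n => closure_subset_iff_isClosed.1 fun s hs => ?_
    obtain ⟨c, ⟨t, ht, hct⟩, hcs⟩ := mem_closure_iff_forall_finset.1 hs (window e (m n))
    exact ⟨t, ht, fun x hx => (hct x hx).trans (hcs x hx)⟩
  have hCanti : ∀ n, C (n + 1) ⊆ C n := by
    rintro n s ⟨t, ht, hts⟩
    obtain ⟨t', ht', htt'⟩ := (h n).symm.exists_mem ht
    exact ⟨t', ht', fun x hx => (htt' x hx).trans (hts x (hW n.le_succ hx))⟩
  have hagree : ∀ n, AgreeOn (window e (m n) : Set G) (S n).1 (⋂ k, C k) := by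
    intro n p
    constructor
    · intro hp
      have hPcl : IsClosed {s : G → A | ∀ x ∈ window e (m n), s x = p x} := by
        simp only [Set.ofPred_forall]
        exact isClosed_iInter fun x => isClosed_iInter fun _ =>
          isClosed_eq (continuous_apply x) continuous_const
      obtain ⟨s, hs⟩ := IsCompact.nonempty_iInter_of_sequence_nonempty_isCompact_isClosed
        (fun k => C k ∩ {s : G → A | ∀ x ∈ window e (m n), s x = p x})
        (fun k => Set.inter_subset_inter_left _ (hCanti k))
        (fun k => by
          obtain ⟨t, ht, htp⟩ := (hchain (le_max_right k n) p).1 hp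
          exact ⟨t, hSC (le_max_left k n) ht, htp⟩)
        ((hCcl 0).inter hPcl).isCompact (fun k => (hCcl k).inter hPcl)
      rw [Set.mem_iInter] at hs
      exact ⟨s, Set.mem_iInter.2 fun k => (hs k).1, (hs 0).2⟩
    · rintro ⟨s, hs, hsp⟩
      obtain ⟨t, ht, hts⟩ := Set.mem_iInter.1 hs n
      exact ⟨t, ht, fun x hx => (hts x hx).trans (hsp x hx)⟩
  refine ⟨⟨⋂ k, C k, ?_, isClosed_iInter hCcl, ?_⟩, hagree⟩
  · obtain ⟨s, hs⟩ := (S 0).2.1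
    obtain ⟨t, ht, -⟩ := (hagree 0).exists_mem hs
    exact ⟨t, ht⟩
  · intro s hs g
    refine Set.mem_iInter.2 fun n => ?_
    obtain ⟨k, hk⟩ := exists_subset_window he ((window e (m n)).image fun x => g⁻¹ * x)
    obtain ⟨t, ht, hts⟩ := Set.mem_iInter.1 hs (max n k)
    obtain ⟨t', ht', htt'⟩ := hSC (le_max_left n k) ((S (max n k)).2.2.2 t ht g)
    refine ⟨t', ht', fun x hx => (htt' x hx).trans (hts _ ?_)⟩
    exact window_mono e ((le_max_right n k).trans hm.le_apply)
      (hk (Finset.mem_image_of_mem _ hx))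

/-- The shifts that have an `F`-window for the first `n` elements `F` of the enumeration and on
which the next element acts nontrivially unless it is the identity. -/
def windowSet (G A : Type*) [Group G] [TopologicalSpace A] (e : ℕ → G) (n : ℕ) :
    Set (ShiftSpace G A) :=
  {S | HasWindow (window e n : Set G) S.1 ∧ (e n ≠ 1 → ∃ s ∈ S.1, shiftAct (e n) s ≠ s)}

open scoped Classical in
theorem exists_forall_agreeOn_mem_windowSet {G A : Type*} [Group G] [TopologicalSpace A]
    {e : ℕ → G} (he : Function.Surjective e) {n : ℕ} {S : ShiftSpace G A}
    (hS : S ∈ windowSet G A e n) : ∃ k, ∀ T : ShiftSpace G A,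
      AgreeOn (window e k : Set G) S.1 T.1 → T ∈ windowSet G A e n := by
  obtain ⟨hw, hf⟩ := hS
  obtain ⟨D, hD⟩ := hw.exists_agreeOn
  have hf' : ∃ D' : Finset G, ∀ T, AgreeOn (D' : Set G) S.1 T →
      e n ≠ 1 → ∃ s ∈ T, shiftAct (e n) s ≠ s := by
    by_cases h1 : e n = 1
    · exact ⟨∅, fun _ _ h => (h h1).elim⟩
    · obtain ⟨s, hs, hne⟩ := hf h1
      obtain ⟨x, hx⟩ := Function.ne_iff.1 hne
      refine ⟨{x, (e n)⁻¹ * x}, fun T hT _ => ?_⟩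
      obtain ⟨t, ht, hts⟩ := hT.exists_mem hs
      refine ⟨t, ht, fun heq => hx ?_⟩
      have := congrFun heq x
      rw [shiftAct, hts _ (by simp), hts _ (by simp)] at this
      exact this
  obtain ⟨D', hD'⟩ := hf'
  obtain ⟨k, hk⟩ := exists_subset_window he (D ∪ D')
  exact ⟨k, fun T hT => ⟨hD _ (hT.mono (Finset.coe_subset.2 (Finset.subset_union_left.trans hk))),
    hD' _ (hT.mono (Finset.coe_subset.2 (Finset.subset_union_right.trans hk)))⟩⟩

theorem HasWindow.mono {G A : Type*} [Group G] {F F' : Set G} {S : Set (G → A)}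
    (h : HasWindow F S) (hF : F' ⊆ F) : HasWindow F' S := by
  obtain ⟨B, hB⟩ := h
  refine ⟨B, fun s hs t ht => ?_⟩
  obtain ⟨⟨g, hg, h₁⟩, k, hk, h₂⟩ := hB s hs t ht
  exact ⟨⟨g, hg, fun x hx => h₁ x (hF hx)⟩, k, hk, fun x hx => h₂ x (hF hx)⟩

theorem minimalShift_of_hasWindow {G A : Type*} [Group G] [TopologicalSpace A]
    [DiscreteTopology A] {S : Set (G → A)} (h : ∀ F : Finset G, HasWindow (F : Set G) S) :
    MinimalShift S := by
  refine fun s hs t ht => mem_closure_iff_forall_finset.2 fun D => ?_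
  obtain ⟨B, hB⟩ := h D
  obtain ⟨g, -, hg⟩ := (hB s hs t ht).2
  exact ⟨shiftAct g⁻¹ s, ⟨g⁻¹, rfl⟩, fun x hx => by simpa [shiftAct] using hg x hx⟩

open scoped Classical in
theorem proximalShift_of_hasWindow {G A : Type*} [Group G] [TopologicalSpace A]
    [DiscreteTopology A] {S : Set (G → A)} (h : ∀ F : Finset G, HasWindow (F : Set G) S)
    (hinv : ∀ s ∈ S, ∀ g : G, shiftAct g s ∈ S) : ProximalShift S := by
  refine fun s hs t ht => ⟨s, hs, mem_closure_iff.2 fun U hU hsU => ?_⟩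
  obtain ⟨u, v, hu, hv, hsu, hsv, huv⟩ := isOpen_prod_iff.1 hU s s hsU
  obtain ⟨D, hD⟩ := exists_finset_forall_mem_of_isOpen hu hsu
  obtain ⟨D', hD'⟩ := exists_finset_forall_mem_of_isOpen hv hsv
  obtain ⟨B, hB⟩ := h (D ∪ D')
  obtain ⟨B', hB'⟩ := h (B * (D ∪ D'))
  obtain ⟨g, -, hg⟩ := (hB' s hs t ht).1
  obtain ⟨k, hk, hks⟩ := (hB _ (hinv s hs g⁻¹) s hs).2
  have h₁ : ∀ x ∈ D ∪ D', shiftAct (g * k)⁻¹ s x = s x := fun x hx => by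
    simpa [shiftAct, mul_assoc] using hks x hx
  have h₂ : ∀ x ∈ D ∪ D', shiftAct (g * k)⁻¹ t x = s x := fun x hx => by
    rw [← h₁ x hx]
    simpa [shiftAct, mul_assoc] using (hg _ (Finset.mul_mem_mul hk hx)).symm
  exact ⟨_, huv ⟨hD _ fun x hx => h₁ x (Finset.mem_union_left _ hx),
    hD' _ fun x hx => h₂ x (Finset.mem_union_right _ hx)⟩, (g * k)⁻¹, rfl⟩

theorem IsShift.exists_apply_ne {G A : Type*} [Group G] [TopologicalSpace A] {S : Set (G → A)}
    (hS : IsShift S) (hne : ¬ ∃ a : A, S = {fun _ => a}) :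
    ∃ s ∈ S, ∃ t ∈ S, ∃ x, s x ≠ t x := by
  by_contra! h
  obtain ⟨s, hs⟩ := hS.1
  refine hne ⟨s 1, Set.eq_singleton_iff_unique_mem.2 ?_⟩
  have hconst : s = fun _ => s 1 := by
    funext x
    have := h s hs _ (hS.2.2 s hs x) x
    simpa [shiftAct] using this
  exact ⟨hconst ▸ hs, fun t ht => (funext fun x => h t ht s hs x).trans hconst⟩

/-- The set `S` takes two values at some point of `F`. -/
def SeparatedOn {G A : Type*} (F : Set G) (S : Set (G → A)) : Prop :=
  ∃ s ∈ S, ∃ t ∈ S, ∃ x ∈ F, s x ≠ t x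

theorem SeparatedOn.of_agreeOn {G A : Type*} {F : Set G} {S T : Set (G → A)}
    (h : SeparatedOn F S) (hST : AgreeOn F S T) : SeparatedOn F T := by
  obtain ⟨s, hs, t, ht, x, hx, hne⟩ := h
  obtain ⟨s', hs', e⟩ := hST.exists_mem hs
  obtain ⟨t', ht', e'⟩ := hST.exists_mem ht
  exact ⟨s', hs', t', ht', x, hx, by rwa [e x hx, e' x hx]⟩

theorem SeparatedOn.mono {G A : Type*} {F F' : Set G} {S : Set (G → A)}
    (h : SeparatedOn F S) (hF : F ⊆ F') : SeparatedOn F' S := by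
  obtain ⟨s, hs, t, ht, x, hx, hne⟩ := h
  exact ⟨s, hs, t, ht, x, hF hx, hne⟩

theorem SeparatedOn.not_exists_eq_singleton {G A : Type*} {F : Set G} {S : Set (G → A)}
    (h : SeparatedOn F S) : ¬ ∃ a : A, S = {fun _ => a} := by
  rintro ⟨a, rfl⟩
  obtain ⟨s, rfl, t, rfl, x, -, hne⟩ := h
  exact hne rfl

theorem IsICC.exists_mem_windowSet {G A : Type*} [Group G] (hG : IsICC G) [Finite A]
    [TopologicalSpace A] [DiscreteTopology A] {e : ℕ → G} (he : Function.Surjective e)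
    (n : ℕ) (S : ShiftSpace G A) (m : ℕ) (hSI : StronglyIrreducible S.1)
    (hsep : SeparatedOn (window e m : Set G) S.1) :
    ∃ (S' : ShiftSpace G A) (m' : ℕ), m < m' ∧ StronglyIrreducible S'.1 ∧
      SeparatedOn (window e m' : Set G) S'.1 ∧ AgreeOn (window e m : Set G) S.1 S'.1 ∧
      ∀ T : ShiftSpace G A, AgreeOn (window e m' : Set G) S'.1 T.1 → T ∈ windowSet G A e n := by
  obtain ⟨S', hS', hSI', hagree, hwin⟩ := hG.exists_hasWindow S.2 hSI (window e (max m n))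
  have hagree' : AgreeOn (window e m : Set G) S.1 S' :=
    hagree.mono (Finset.coe_subset.2 (window_mono e (le_max_left m n)))
  have hsep' := hsep.of_agreeOn hagree'
  obtain ⟨k, hk⟩ := exists_forall_agreeOn_mem_windowSet he (n := n) (S := ⟨S', hS'⟩)
    ⟨hwin.mono (Finset.coe_subset.2 (window_mono e (le_max_right m n))), by
      obtain ⟨s, hs, t, ht, x, -, hne⟩ := hsep'
      exact hG.faithfulShift hSI' ⟨s, hs, t, ht, fun h => hne (congrFun h x)⟩ hS'.2.2 _⟩
  refine ⟨⟨S', hS'⟩, max (m + 1) k, by simp, hSI', hsep'.mono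
    (Finset.coe_subset.2 (window_mono e ?_)), hagree', fun T hT => hk T (hT.mono
    (Finset.coe_subset.2 (window_mono e (le_max_right _ _))))⟩
  exact m.le_succ.trans (le_max_left _ _)

theorem IsICC.exists_limit_mem_windowSet {G A : Type*} [Group G] (hG : IsICC G) [Finite A]
    [TopologicalSpace A] [DiscreteTopology A] {e : ℕ → G} (he : Function.Surjective e)
    (S : ShiftSpace G A) (m : ℕ) (hSI : StronglyIrreducible S.1)
    (hsep : SeparatedOn (window e m : Set G) S.1) :
    ∃ T ∈ scriptS G A e, AgreeOn (window e m : Set G) S.1 T.1 ∧ ∀ n, T ∈ windowSet G A e n := by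
  let Q : Type _ := {q : ShiftSpace G A × ℕ //
    StronglyIrreducible q.1.1 ∧ SeparatedOn (window e q.2 : Set G) q.1.1}
  have hstep : ∀ (n : ℕ) (q : Q), ∃ q' : Q, q.1.2 < q'.1.2 ∧
      AgreeOn (window e q.1.2 : Set G) q.1.1.1 q'.1.1.1 ∧ ∀ T : ShiftSpace G A,
        AgreeOn (window e q'.1.2 : Set G) q'.1.1.1 T.1 → T ∈ windowSet G A e n := by
    rintro n ⟨⟨S, m⟩, hSI, hsep⟩
    obtain ⟨S', m', hm, hSI', hsep', hagree, hT⟩ := hG.exists_mem_windowSet he n S m hSI hsep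
    exact ⟨⟨⟨S', m'⟩, hSI', hsep'⟩, hm, hagree, hT⟩
  choose f hlt hagree hmem using hstep
  let q : ℕ → Q := fun n => Nat.rec ⟨⟨S, m⟩, hSI, hsep⟩ f n
  have hm : StrictMono fun n => (q n).1.2 := strictMono_nat_of_lt_succ fun n => hlt n (q n)
  obtain ⟨T, hT⟩ := exists_shift_forall_agreeOn he (fun n => (q n).1.1) (fun n => (q n).1.2) hm
    (fun n => hagree n (q n))
  refine ⟨T, ⟨(mem_closure_shiftSpaceTopology_iff he).2 fun n =>
    ⟨(q n).1.1, (q n).2.1, (hT n).symm.mono (Finset.coe_subset.2 (window_mono e hm.le_apply))⟩,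
    (hsep.of_agreeOn (hT 0)).not_exists_eq_singleton⟩, hT 0, fun n => hmem n (q n) T (hT (n + 1))⟩

theorem isShift_univ (G A : Type*) [Group G] [Nonempty A] [TopologicalSpace A] :
    IsShift (Set.univ : Set (G → A)) :=
  ⟨Set.univ_nonempty, isClosed_univ, fun _ _ _ => trivial⟩

open scoped Classical in
theorem stronglyIrreducible_univ (G A : Type*) [Group G] :
    StronglyIrreducible (Set.univ : Set (G → A)) := by
  refine stronglyIrreducible_iff.2 ⟨{1}, by simp, fun E₁ E₂ hE s₁ _ s₂ _ => ?_⟩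
  refine ⟨fun x => if x ∈ E₁ then s₁ x else s₂ x, trivial, fun x hx => by simp [hx],
    fun x hx => ?_⟩
  simp only [Finset.coe_singleton, Set.singleton_one, mul_one] at hE
  simp [Set.disjoint_right.1 hE hx]

theorem separatedOn_univ {G A : Type*} [Nontrivial A] {F : Set G} (hF : F.Nonempty) :
    SeparatedOn F (Set.univ : Set (G → A)) := by
  obtain ⟨a, b, hab⟩ := exists_pair_ne A
  obtain ⟨x, hx⟩ := hF
  exact ⟨fun _ => a, trivial, fun _ => b, trivial, x, hx, hab⟩

/-- For a countable ICC group `G` and a finite alphabet `A` with `|A| ≥ 2`, the set of shifts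
in `𝒮` on which the `G`-action is faithful, minimal and proximal contains a dense `G_δ`
subset of `𝒮`; in particular it is nonempty. -/
theorem faithful_minimal_proximal_contains_dense_Gδ
    (G : Type) [Group G] [Countable G] (hICC : IsICC G)
    (A : Type) [Fintype A] [TopologicalSpace A] [DiscreteTopology A]
    (hA : 2 ≤ Fintype.card A)
    (e : ℕ → G) (he : Function.Surjective e) :
    (∃ R : Set ↥(scriptS G A e),
      @Dense ↥(scriptS G A e) (scriptSTopology G A e) R ∧
      @IsGδ ↥(scriptS G A e) (scriptSTopology G A e) R ∧
      R ⊆ {S : ↥(scriptS G A e) |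
        FaithfulShift S.1.1 ∧ MinimalShift S.1.1 ∧ ProximalShift S.1.1}) ∧
    {S : ↥(scriptS G A e) |
      FaithfulShift S.1.1 ∧ MinimalShift S.1.1 ∧ ProximalShift S.1.1}.Nonempty := by
  have hwin : ∀ S : ShiftSpace G A, (∀ n, S ∈ windowSet G A e n) →
      ∀ F : Finset G, HasWindow (F : Set G) S.1 := by
    intro S hS F
    obtain ⟨n, hn⟩ := exists_subset_window he F
    exact (hS n).1.mono (Finset.coe_subset.2 hn)
  have hsub : ∀ S : ShiftSpace G A, (∀ n, S ∈ windowSet G A e n) →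
      FaithfulShift S.1 ∧ MinimalShift S.1 ∧ ProximalShift S.1 := by
    refine fun S hS => ⟨fun g hg => ?_, minimalShift_of_hasWindow (hwin S hS),
      proximalShift_of_hasWindow (hwin S hS) S.2.2.2⟩
    obtain ⟨n, rfl⟩ := he g
    exact (hS n).2 hg
  constructor
  · let _ := shiftSpaceTopology G A e
    refine ⟨{S | ∀ n, S.1 ∈ windowSet G A e n}, ?_, ?_, fun S hS => hsub S.1 hS⟩
    · let _ := scriptSTopology G A e
      refine fun S => mem_closure_iff.2 fun U hU hSU => ?_
      obtain ⟨V, hV, rfl⟩ := isOpen_induced_iff.1 hU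
      obtain ⟨n, hn⟩ := (isOpen_shiftSpaceTopology_iff he).1 hV S.1 hSU
      obtain ⟨s, hs, t, ht, x, hx⟩ := S.1.2.exists_apply_ne S.2.2
      obtain ⟨k, hk⟩ := exists_subset_window he {x}
      have hsep : SeparatedOn (window e (max n k) : Set G) S.1.1 := ⟨s, hs, t, ht, x,
        window_mono e (le_max_right n k) (hk (Finset.mem_singleton_self x)), hx⟩
      obtain ⟨S', hSI, hS'⟩ := (mem_closure_shiftSpaceTopology_iff he).1 S.2.1 (max n k)
      obtain ⟨T, hT, hagree, hTw⟩ := hICC.exists_limit_mem_windowSet he S' _ hSI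
        (hsep.of_agreeOn hS')
      exact ⟨⟨T, hT⟩, hn T ((hS'.trans hagree).mono
        (Finset.coe_subset.2 (window_mono e (le_max_left n k)))), hTw⟩
    · let _ := scriptSTopology G A e
      rw [Set.ofPred_forall]
      refine IsGδ.iInter fun n => IsOpen.isGδ (isOpen_induced_iff.2 ⟨windowSet G A e n, ?_, rfl⟩)
      exact (isOpen_shiftSpaceTopology_iff he).2 fun S hS =>
        exists_forall_agreeOn_mem_windowSet he hS
  · have : Nontrivial A := Fintype.one_lt_card_iff_nontrivial.1 hA
    obtain ⟨T, hT, -, hTw⟩ := hICC.exists_limit_mem_windowSet he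
      ⟨Set.univ, isShift_univ G A⟩ 1 (stronglyIrreducible_univ G A)
      (separatedOn_univ ⟨e 0, by simp [window]⟩)
    exact ⟨⟨T, hT⟩, hsub T hTw⟩
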